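/- arXiv:1912.12930 — 3 statements merged into one kernel-verified Lean document; each statement's English description precedes it below -/
import Mathlib

section
/- For every positive definite integral binary quadratic form ℓ, there exist infinitely many pairwise non-isometric positive definite integral binary quadratic forms ℓ′ such that the positive definite integral quaternary quadratic forms representing both ℓ and ℓ′ fall into only finitely many isometry classes; that is, there is a finite list of quaternary forms such that every positive definite integral quaternary form representing both ℓ and ℓ′ is isometric to a form in the list. -/
open Matrix

/-- A positive definite integral quadratic form of rank `m`. -/
def IsPDForm {m : ℕ} (M : Matrix (Fin m) (Fin m) ℤ) : Prop :=
  M.IsSymm ∧ ∀ x : Fin m → ℤ, x ≠ 0 → 0 < x ⬝ᵥ M.mulVec x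

/-- `N` is represented by `L` if `Tᵀ L T = N` for some integer matrix `T`. -/
def Represents {n m : ℕ} (L : Matrix (Fin n) (Fin n) ℤ)
    (N : Matrix (Fin m) (Fin m) ℤ) : Prop :=
  ∃ T : Matrix (Fin n) (Fin m) ℤ, Tᵀ * L * T = N

/-- An integer `a` is represented by the form `M`. -/
def RepresentsInt {m : ℕ} (M : Matrix (Fin m) (Fin m) ℤ) (a : ℤ) : Prop :=
  ∃ x : Fin m → ℤ, x ⬝ᵥ M.mulVec x = a

/-- Two integral forms of rank `n` are isometric. -/
def IsomForm {n : ℕ} (A B : Matrix (Fin n) (Fin n) ℤ) : Prop :=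
  ∃ U : Matrix (Fin n) (Fin n) ℤ, IsUnit U.det ∧ Uᵀ * A * U = B



/-- A number congruent to 3 mod 4 has a prime factor congruent to 3 mod 4. -/
lemma exists_prime_three_mod_four (n : ℕ) (hn : n % 4 = 3) :
    ∃ p : ℕ, p.Prime ∧ p % 4 = 3 ∧ p ∣ n := by
  induction n using Nat.strong_induction_on with
  | _ n ih =>
    have hn1 : n ≠ 1 := by omega
    obtain ⟨q, hq, k, rfl⟩ := Nat.exists_prime_and_dvd hn1
    by_cases h3 : q % 4 = 3
    · exact ⟨q, hq, h3, dvd_mul_right _ _⟩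
    · have hk : k % 4 = 3 := by
        have h1 : q % 4 < 4 := Nat.mod_lt _ (by norm_num)
        have h2 : k % 4 < 4 := Nat.mod_lt _ (by norm_num)
        rw [Nat.mul_mod] at hn
        generalize q % 4 = a at *
        generalize k % 4 = b at *
        interval_cases a <;> interval_cases b <;> simp_all
      have hk0 : 0 < k := by omega
      have hlt : k < q * k := by nlinarith [hq.two_le]
      obtain ⟨p, hp, hp3, hpk⟩ := ih k hlt hk
      exact ⟨p, hp, hp3, hpk.mul_left _⟩

lemma dvd_of_dvd_sq_add_sq (p : ℕ) (hp : p.Prime) (h3 : p % 4 = 3) (u y : ℤ)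
    (h : (p : ℤ) ∣ u ^ 2 + y ^ 2) : (p : ℤ) ∣ y := by
  have : Fact p.Prime := ⟨hp⟩
  rw [← ZMod.intCast_zmod_eq_zero_iff_dvd] at h ⊢
  by_contra hy
  push_cast at h
  exact ZMod.mod_four_ne_three_of_sq_eq_neg_sq' hy (eq_neg_of_add_eq_zero_left h) h3

/-- Anisotropy modulo a suitable prime. -/
lemma exists_aniso_prime (a b c : ℤ) (hd : 0 < a * c - b ^ 2) :
    ∃ p : ℕ, p.Prime ∧ ∀ x y : ℤ, (p : ℤ) ∣ a * x ^ 2 + 2 * b * x * y + c * y ^ 2 →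
      (p : ℤ) ∣ x ∧ (p : ℤ) ∣ y := by
  obtain ⟨d, hdd⟩ : ∃ d : ℕ, (d : ℤ) = a * c - b ^ 2 := ⟨(a * c - b ^ 2).toNat, by omega⟩
  have hd0 : 0 < d := by omega
  obtain ⟨p, hp, h3, hpd⟩ := exists_prime_three_mod_four (4 * d - 1) (by omega)
  have hpd' : (p : ℤ) ∣ 4 * (a * c - b ^ 2) - 1 := by
    rw [← hdd]
    have := Int.natCast_dvd_natCast.mpr hpd
    rwa [Nat.cast_sub (by omega), Nat.cast_mul] at this
  refine ⟨p, hp, fun x y h => ⟨?_, ?_⟩⟩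
  · apply dvd_of_dvd_sq_add_sq p hp h3 (2 * (b * x + c * y))
    have : (2 * (b * x + c * y)) ^ 2 + x ^ 2 =
        4 * c * (a * x ^ 2 + 2 * b * x * y + c * y ^ 2)
          - (4 * (a * c - b ^ 2) - 1) * x ^ 2 := by ring
    rw [this]
    exact dvd_sub (h.mul_left _) (hpd'.mul_right _)
  · apply dvd_of_dvd_sq_add_sq p hp h3 (2 * (a * x + b * y))
    have : (2 * (a * x + b * y)) ^ 2 + y ^ 2 =
        4 * a * (a * x ^ 2 + 2 * b * x * y + c * y ^ 2)
          - (4 * (a * c - b ^ 2) - 1) * y ^ 2 := by ring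
    rw [this]
    exact dvd_sub (h.mul_left _) (hpd'.mul_right _)

/-- Infinite descent. -/
lemma descent (a b c : ℤ) (p : ℕ) (hp : p.Prime)
    (h : ∀ x y : ℤ, (p : ℤ) ∣ a * x ^ 2 + 2 * b * x * y + c * y ^ 2 →
      (p : ℤ) ∣ x ∧ (p : ℤ) ∣ y) (n : ℕ) :
    ∀ x y z w : ℤ, x.natAbs + y.natAbs ≤ n →
      a * x ^ 2 + 2 * b * x * y + c * y ^ 2 = p * (a * z ^ 2 + 2 * b * z * w + c * w ^ 2) →
      x = 0 ∧ y = 0 := by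
  have hp0 : (p : ℤ) ≠ 0 := by exact_mod_cast hp.ne_zero
  induction n with
  | zero => intro x y z w hn _; omega
  | succ n ih =>
    intro x y z w hn he
    obtain ⟨⟨x', rfl⟩, ⟨y', rfl⟩⟩ := h x y ⟨_, he⟩
    have he2 : a * z ^ 2 + 2 * b * z * w + c * w ^ 2 =
        p * (a * x' ^ 2 + 2 * b * x' * y' + c * y' ^ 2) := by
      apply mul_left_cancel₀ hp0
      rw [← he]; ring
    obtain ⟨⟨z', rfl⟩, ⟨w', rfl⟩⟩ := h z w ⟨_, he2⟩
    have he3 : a * x' ^ 2 + 2 * b * x' * y' + c * y' ^ 2 =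
        p * (a * z' ^ 2 + 2 * b * z' * w' + c * w' ^ 2) := by
      apply mul_left_cancel₀ hp0
      rw [← he2]; ring
    by_cases h0 : x' = 0 ∧ y' = 0
    · simp [h0.1, h0.2]
    · have hlt : x'.natAbs + y'.natAbs ≤ n := by
        simp only [Int.natAbs_mul, Int.natAbs_natCast] at hn
        have h2 := hp.two_le
        have : 0 < x'.natAbs + y'.natAbs := by omega
        nlinarith
      exact absurd (ih x' y' z' w' hlt he3) h0

lemma quad_two (ℓ : Matrix (Fin 2) (Fin 2) ℤ) (hs : ℓ.IsSymm) (x : Fin 2 → ℤ) :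
    x ⬝ᵥ ℓ.mulVec x = ℓ 0 0 * x 0 ^ 2 + 2 * ℓ 0 1 * x 0 * x 1 + ℓ 1 1 * x 1 ^ 2 := by
  have : ℓ 1 0 = ℓ 0 1 := hs.apply 0 1
  simp [Matrix.mulVec, dotProduct, Fin.sum_univ_two, this]
  ring

lemma det_pos_two (ℓ : Matrix (Fin 2) (Fin 2) ℤ) (h : IsPDForm ℓ) :
    0 < ℓ 0 0 * ℓ 1 1 - ℓ 0 1 ^ 2 := by
  have ha := h.2 ![1, 0] (by intro h; simpa using congrFun h 0)
  rw [quad_two ℓ h.1] at ha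
  simp at ha
  have hb := h.2 ![-ℓ 0 1, ℓ 0 0] (by intro h; have := congrFun h 1; simp at this; omega)
  rw [quad_two ℓ h.1] at hb
  simp at hb
  have : 0 < ℓ 0 0 * (ℓ 0 0 * ℓ 1 1 - ℓ 0 1 ^ 2) := by nlinarith
  exact pos_of_mul_pos_right this ha.le

lemma quad_congr {n m : ℕ} (L : Matrix (Fin n) (Fin n) ℤ) (T : Matrix (Fin n) (Fin m) ℤ)
    (x : Fin m → ℤ) : x ⬝ᵥ (Tᵀ * L * T).mulVec x = (T.mulVec x) ⬝ᵥ L.mulVec (T.mulVec x) := by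
  rw [← Matrix.mulVec_mulVec, ← Matrix.mulVec_mulVec, Matrix.dotProduct_mulVec,
    Matrix.vecMul_transpose]

lemma det_ne_zero_of_pd {n : ℕ} (G : Matrix (Fin n) (Fin n) ℤ) (h : IsPDForm G) :
    G.det ≠ 0 := by
  intro h0
  obtain ⟨v, hv, hv0⟩ := Matrix.exists_mulVec_eq_zero_iff.mpr h0
  have := h.2 v hv
  simp [hv0] at this

lemma entry_bound {n : ℕ} (G : Matrix (Fin n) (Fin n) ℤ) (h : IsPDForm G) (i j : Fin n) :
    |2 * G i j| ≤ G i i + G j j := by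
  have hnn : ∀ x : Fin n → ℤ, 0 ≤ x ⬝ᵥ G.mulVec x := by
    intro x
    by_cases hx : x = 0
    · simp [hx]
    · exact (h.2 x hx).le
  have hs : G j i = G i j := h.1.apply i j
  have h1 := hnn (Pi.single i 1 + Pi.single j 1)
  have h2 := hnn (Pi.single i 1 - Pi.single j 1)
  simp [Matrix.mulVec_add, Matrix.mulVec_sub, hs] at h1 h2
  rw [abs_le]
  constructor <;> linarith

lemma finite_bounded (n : ℕ) (C : ℤ) :
    {G : Matrix (Fin n) (Fin n) ℤ | ∀ i j, |G i j| ≤ C}.Finite := by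
  have : {G : Fin n → Fin n → ℤ | ∀ i, G i ∈ {r : Fin n → ℤ | ∀ j, r j ∈ Set.Icc (-C) C}}.Finite :=
    Set.Finite.pi' fun _ => Set.Finite.pi' fun _ => Set.finite_Icc _ _
  refine this.subset ?_
  intro G hG i j
  exact ⟨(abs_le.mp (hG i j)).1, (abs_le.mp (hG i j)).2⟩

/-- Data of a sublattice with Gram matrix `G`. -/
lemma overlattice_isom {n : ℕ} (G L L' M M' A A' : Matrix (Fin n) (Fin n) ℤ) (g : ℤ) (hg : g ≠ 0)
    (hM : Mᵀ * L * M = G) (hM' : M'ᵀ * L' * M' = G)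
    (hMA : M * A = g • 1) (hAM : A * M = g • 1)
    (hMA' : M' * A' = g • 1) (hAM' : A' * M' = g • 1)
    (hk : ∀ v : Fin n → ℤ, (∃ w z, v = A.mulVec w + g • z) ↔ (∃ w z, v = A'.mulVec w + g • z)) :
    IsomForm L L' := by
  have key : ∀ (A A' M : Matrix (Fin n) (Fin n) ℤ), A * M = g • 1 →
      (∀ v : Fin n → ℤ, (∃ w z, v = A'.mulVec w + g • z) → (∃ w z, v = A.mulVec w + g • z)) →
      ∃ U, A * U = A' := by
    intro A A' M hAM h
    have : ∀ j, ∃ u : Fin n → ℤ, A.mulVec u = A'.col j := by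
      intro j
      obtain ⟨w, z, hwz⟩ := h (A'.col j) ⟨Pi.single j 1, 0, by simp⟩
      refine ⟨w + M.mulVec z, ?_⟩
      rw [hwz, Matrix.mulVec_add, Matrix.mulVec_mulVec, hAM, Matrix.smul_mulVec, Matrix.one_mulVec]
    choose u hu using this
    refine ⟨Matrix.of fun i j => u j i, ?_⟩
    ext i j
    exact congrFun (hu j) i
  obtain ⟨U, hU⟩ := key A A' M hAM (fun v => (hk v).2)
  obtain ⟨V, hV⟩ := key A' A M' hAM' (fun v => (hk v).1)
  have hUV : U * V = 1 := by
    have h1 : A * (U * V) = A := by rw [← mul_assoc, hU, hV]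
    have h2 : (M * A) * (U * V) = M * A := by rw [mul_assoc, h1]
    rw [hMA] at h2
    simp only [Matrix.smul_mul, one_mul] at h2
    exact smul_right_injective _ hg h2
  have hL : ∀ (L M A : Matrix (Fin n) (Fin n) ℤ), Mᵀ * L * M = G → M * A = g • 1 →
      Aᵀ * G * A = (g * g) • L := by
    intro L M A h1 h2
    have h3 : Aᵀ * Mᵀ = g • 1 := by rw [← Matrix.transpose_mul, h2]; simp
    calc Aᵀ * G * A = (Aᵀ * Mᵀ) * L * (M * A) := by rw [← h1]; simp only [mul_assoc]
      _ = (g * g) • L := by rw [h2, h3, Matrix.smul_mul, Matrix.mul_smul, one_mul, mul_one,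
          smul_smul]
  refine ⟨U, IsUnit.of_mul_eq_one V.det (by rw [← Matrix.det_mul, hUV, Matrix.det_one]), ?_⟩
  apply smul_right_injective _ (mul_ne_zero hg hg)
  change (g * g) • (Uᵀ * L * U) = (g * g) • L'
  rw [← hL L' M' A' hM' hMA', ← hU, Matrix.transpose_mul]
  calc (g * g) • (Uᵀ * L * U) = Uᵀ * ((g * g) • L) * U := by
        rw [Matrix.mul_smul, Matrix.smul_mul]
    _ = _ := by rw [← hL L M A hM hMA]; simp only [mul_assoc]

/-- Finitely many classes contain a sublattice with given nondegenerate Gram matrix. -/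
lemma finite_classes_gram {n : ℕ} (G : Matrix (Fin n) (Fin n) ℤ) (hG : G.det ≠ 0) :
    ∃ F : Set (Matrix (Fin n) (Fin n) ℤ), F.Finite ∧
      ∀ L M : Matrix (Fin n) (Fin n) ℤ, Mᵀ * L * M = G → ∃ L' ∈ F, IsomForm L L' := by
  classical
  set g := G.det with hgdef
  have : NeZero g.natAbs := ⟨by simpa using hG⟩
  let P : Set (Fin n → ZMod g.natAbs) → Matrix (Fin n) (Fin n) ℤ → Prop := fun S L =>
    ∃ M A : Matrix (Fin n) (Fin n) ℤ, Mᵀ * L * M = G ∧ M * A = g • 1 ∧ A * M = g • 1 ∧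
      S = {s | ∃ w : Fin n → ℤ, s = fun i => ((A.mulVec w i : ℤ) : ZMod g.natAbs)}
  let r : Set (Fin n → ZMod g.natAbs) → Matrix (Fin n) (Fin n) ℤ := fun S =>
    if h : ∃ L, P S L then h.choose else 0
  refine ⟨Set.range r, Set.finite_range r, ?_⟩
  intro L M hM
  have hdet : M.det * L.det * M.det = g := by
    rw [hgdef, ← hM]; simp
  obtain ⟨A, hMA, hAM⟩ : ∃ A : Matrix (Fin n) (Fin n) ℤ, M * A = g • 1 ∧ A * M = g • 1 := by
    refine ⟨(M.det * L.det) • M.adjugate, ?_, ?_⟩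
    · rw [Matrix.mul_smul, Matrix.mul_adjugate, smul_smul, hdet]
    · rw [Matrix.smul_mul, Matrix.adjugate_mul, smul_smul, hdet]
  have hP : ∃ L, P {s | ∃ w : Fin n → ℤ, s = fun i => ((A.mulVec w i : ℤ) : ZMod g.natAbs)} L :=
    ⟨L, M, A, hM, hMA, hAM, rfl⟩
  refine ⟨_, ⟨{s | ∃ w : Fin n → ℤ, s = fun i => ((A.mulVec w i : ℤ) : ZMod g.natAbs)}, rfl⟩, ?_⟩
  simp only [r, dif_pos hP]
  obtain ⟨M', A', hM', hMA', hAM', hS⟩ := hP.choose_spec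
  refine overlattice_isom G L _ M M' A A' g hG hM hM' hMA hAM hMA' hAM' ?_
  have conv : ∀ (B : Matrix (Fin n) (Fin n) ℤ) (v : Fin n → ℤ),
      (∃ w z, v = B.mulVec w + g • z) ↔
      (fun i => ((v i : ℤ) : ZMod g.natAbs)) ∈
        {s | ∃ w : Fin n → ℤ, s = fun i => ((B.mulVec w i : ℤ) : ZMod g.natAbs)} := by
    intro B v
    constructor
    · rintro ⟨w, z, rfl⟩
      refine ⟨w, funext fun i => ?_⟩
      have : ((g : ℤ) : ZMod g.natAbs) = 0 := by
        rw [ZMod.intCast_zmod_eq_zero_iff_dvd]; simp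
      simp [this]
    · rintro ⟨w, hw⟩
      have : ∀ i, ∃ z, v i = B.mulVec w i + g * z := by
        intro i
        have h1 := congrFun hw i
        rw [← sub_eq_zero, ← Int.cast_sub, ZMod.intCast_zmod_eq_zero_iff_dvd,
          Int.natAbs_dvd] at h1
        obtain ⟨z, hz⟩ := h1
        exact ⟨z, by linarith⟩
      choose z hz using this
      exact ⟨w, z, funext fun i => by simp [hz]⟩
  intro v
  rw [conv, conv, hS]

/-- If two binary forms share no nonzero value, then finitely many classes represent both. -/
lemma finite_classes_pair (ℓ ℓ' : Matrix (Fin 2) (Fin 2) ℤ) (_hℓ : IsPDForm ℓ)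
    (hno : ∀ x y : Fin 2 → ℤ, x ⬝ᵥ ℓ.mulVec x = y ⬝ᵥ ℓ'.mulVec y → x = 0 ∧ y = 0) :
    ∃ F : Set (Matrix (Fin 4) (Fin 4) ℤ), F.Finite ∧
      ∀ L : Matrix (Fin 4) (Fin 4) ℤ, IsPDForm L →
          Represents L ℓ → Represents L ℓ' → ∃ L' ∈ F, IsomForm L L' := by
  classical
  set C : ℤ := |ℓ 0 0| + |ℓ 1 1| + |ℓ' 0 0| + |ℓ' 1 1| with hC
  have hfin := finite_bounded 4 C
  have hex : ∀ G : Matrix (Fin 4) (Fin 4) ℤ, ∃ F : Set (Matrix (Fin 4) (Fin 4) ℤ), F.Finite ∧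
      (G.det ≠ 0 → ∀ L M : Matrix (Fin 4) (Fin 4) ℤ, Mᵀ * L * M = G →
        ∃ L' ∈ F, IsomForm L L') := by
    intro G
    by_cases h : G.det = 0
    · exact ⟨∅, Set.finite_empty, fun h' => absurd h h'⟩
    · obtain ⟨F, h1, h2⟩ := finite_classes_gram G h
      exact ⟨F, h1, fun _ => h2⟩
  choose F hF hF' using hex
  refine ⟨_, hfin.biUnion (fun G _ => hF G), ?_⟩
  rintro L hL ⟨T₁, hT₁⟩ ⟨T₂, hT₂⟩
  let M : Matrix (Fin 4) (Fin 4) ℤ :=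
    Matrix.of fun i => ![T₁ i 0, T₁ i 1, T₂ i 0, T₂ i 1]
  have hMv : ∀ v : Fin 4 → ℤ, M.mulVec v =
      T₁.mulVec ![v 0, v 1] + T₂.mulVec ![v 2, v 3] := by
    intro v
    ext i
    simp [M, Matrix.mulVec, dotProduct, Fin.sum_univ_four, Fin.sum_univ_two]
    ring
  have hinj : ∀ v, M.mulVec v = 0 → v = 0 := by
    intro v hv
    rw [hMv] at hv
    have h1 : T₁.mulVec ![v 0, v 1] = - T₂.mulVec ![v 2, v 3] := eq_neg_of_add_eq_zero_left hv
    have h2 := hno ![v 0, v 1] ![v 2, v 3] (by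
      rw [← hT₁, ← hT₂, quad_congr, quad_congr, h1]
      simp [Matrix.mulVec_neg])
    have h3 := congrFun h2.1 0
    have h4 := congrFun h2.1 1
    have h5 := congrFun h2.2 0
    have h6 := congrFun h2.2 1
    simp at h3 h4 h5 h6
    ext i
    fin_cases i <;> simp [h3, h4, h5, h6]
  have hGpd : IsPDForm (Mᵀ * L * M) := by
    refine ⟨?_, fun x hx => ?_⟩
    · have := hL.1.eq
      simp [Matrix.IsSymm, Matrix.transpose_mul, this, mul_assoc]
    · rw [quad_congr]
      exact hL.2 _ fun h => hx (hinj x h)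
  have hdiag : ∀ i, (Mᵀ * L * M) i i ≤ C := by
    have hd1 : ∀ i, (Mᵀ * L * M) i i =
        (M.mulVec (Pi.single i 1)) ⬝ᵥ L.mulVec (M.mulVec (Pi.single i 1)) := by
      intro i
      rw [← quad_congr]; simp
    have hd2 : ∀ i, ℓ i i =
        (T₁.mulVec (Pi.single i 1)) ⬝ᵥ L.mulVec (T₁.mulVec (Pi.single i 1)) := by
      intro i
      rw [← quad_congr, hT₁]; simp
    have hd3 : ∀ i, ℓ' i i =
        (T₂.mulVec (Pi.single i 1)) ⬝ᵥ L.mulVec (T₂.mulVec (Pi.single i 1)) := by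
      intro i
      rw [← quad_congr, hT₂]; simp
    have a1 := le_abs_self (ℓ 0 0)
    have a2 := le_abs_self (ℓ 1 1)
    have a3 := le_abs_self (ℓ' 0 0)
    have a4 := le_abs_self (ℓ' 1 1)
    have b1 := abs_nonneg (ℓ 0 0)
    have b2 := abs_nonneg (ℓ 1 1)
    have b3 := abs_nonneg (ℓ' 0 0)
    have b4 := abs_nonneg (ℓ' 1 1)
    have c1 : M.mulVec (Pi.single 0 1) = T₁.mulVec (Pi.single 0 1) := by
      ext i; simp [M]
    have c2 : M.mulVec (Pi.single 1 1) = T₁.mulVec (Pi.single 1 1) := by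
      ext i; simp [M]
    have c3 : M.mulVec (Pi.single 2 1) = T₂.mulVec (Pi.single 0 1) := by
      ext i; simp [M]
    have c4 : M.mulVec (Pi.single 3 1) = T₂.mulVec (Pi.single 1 1) := by
      ext i; simp [M]
    have e1 : (Mᵀ * L * M) 0 0 = ℓ 0 0 := by rw [hd1, c1, ← hd2]
    have e2 : (Mᵀ * L * M) 1 1 = ℓ 1 1 := by rw [hd1, c2, ← hd2]
    have e3 : (Mᵀ * L * M) 2 2 = ℓ' 0 0 := by rw [hd1, c3, ← hd3]
    have e4 : (Mᵀ * L * M) 3 3 = ℓ' 1 1 := by rw [hd1, c4, ← hd3]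
    intro i
    match i with
    | 0 => rw [e1]; linarith
    | 1 => rw [e2]; linarith
    | 2 => rw [e3]; linarith
    | 3 => rw [e4]; linarith
  obtain ⟨L', hL', hiso⟩ := hF' (Mᵀ * L * M) (det_ne_zero_of_pd _ hGpd) L M rfl
  refine ⟨L', Set.mem_biUnion ?_ hL', hiso⟩
  intro i j
  have h1 := entry_bound _ hGpd i j
  have h2 := hdiag i
  have h3 := hdiag j
  rw [abs_mul, abs_two] at h1
  linarith

/-- For every positive definite integral binary form ℓ there are infinitely many pairwise
non-isometric binary forms ℓ′ such that only finitely many isometry classes of quaternary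
forms represent both ℓ and ℓ′. -/
theorem finitely_many_quaternary_representing_pair (ℓ : Matrix (Fin 2) (Fin 2) ℤ)
    (hℓ : IsPDForm ℓ) :
    ∃ f : ℕ → Matrix (Fin 2) (Fin 2) ℤ,
      (∀ i, IsPDForm (f i)) ∧
      (∀ i j, i ≠ j → ¬ IsomForm (f i) (f j)) ∧
      (∀ i, ∃ (t : ℕ) (Ls : Fin t → Matrix (Fin 4) (Fin 4) ℤ),
        ∀ L : Matrix (Fin 4) (Fin 4) ℤ, IsPDForm L →
          Represents L ℓ → Represents L (f i) → ∃ k, IsomForm L (Ls k)) := by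
  obtain ⟨p, hp, hani⟩ := exists_aniso_prime _ _ _ (det_pos_two ℓ hℓ)
  have hp0 : (0 : ℤ) < p := by exact_mod_cast hp.pos
  have hc : ∀ i : ℕ, (0 : ℤ) < p * ((i : ℤ) + 1) ^ 2 := fun i => by positivity
  have hpd : ∀ i : ℕ, IsPDForm (((p : ℤ) * ((i : ℤ) + 1) ^ 2) • ℓ) := by
    intro i
    refine ⟨hℓ.1.smul _, fun x hx => ?_⟩
    rw [Matrix.smul_mulVec, dotProduct_smul, smul_eq_mul]
    exact mul_pos (hc i) (hℓ.2 x hx)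
  refine ⟨fun i => ((p : ℤ) * ((i : ℤ) + 1) ^ 2) • ℓ, hpd, ?_, ?_⟩
  · rintro i j hij ⟨U, hU, h⟩
    apply hij
    have h1 := congrArg Matrix.det h
    have hU2 : U.det * U.det = 1 := by
      rcases Int.isUnit_iff.mp hU with h | h <;> rw [h] <;> norm_num
    simp only [Matrix.det_mul, Matrix.det_transpose, Matrix.det_smul, Fintype.card_fin] at h1
    have h2 : ((p : ℤ) * ((i : ℤ) + 1) ^ 2) ^ 2 * ℓ.det =
        ((p : ℤ) * ((j : ℤ) + 1) ^ 2) ^ 2 * ℓ.det := by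
      rw [← h1]
      linear_combination (-(((p : ℤ) * ((i : ℤ) + 1) ^ 2) ^ 2 * ℓ.det)) * hU2
    have h3 := mul_right_cancel₀ (det_ne_zero_of_pd ℓ hℓ) h2
    have h4 := (pow_left_inj₀ (hc i).le (hc j).le two_ne_zero).mp h3
    have h5 := mul_left_cancel₀ hp0.ne' h4
    have h6 := (pow_left_inj₀ (by positivity) (by positivity) two_ne_zero).mp h5
    exact_mod_cast add_right_cancel h6
  · intro i
    obtain ⟨F, hF, hF'⟩ := finite_classes_pair ℓ (((p : ℤ) * ((i : ℤ) + 1) ^ 2) • ℓ) hℓ (by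
      intro x y hxy
      have hx : x = 0 := by
        have h0 := descent _ _ _ p hp hani _ (x 0) (x 1) (((i : ℤ) + 1) * y 0)
          (((i : ℤ) + 1) * y 1) le_rfl (by
            rw [Matrix.smul_mulVec, dotProduct_smul, smul_eq_mul, quad_two ℓ hℓ.1,
              quad_two ℓ hℓ.1] at hxy
            rw [hxy]; ring)
        ext k
        fin_cases k
        · exact h0.1
        · exact h0.2
      refine ⟨hx, ?_⟩
      by_contra hy
      have := (hpd i).2 y hy
      rw [← hxy, hx] at this
      simp at this)
    have := hF.to_subtype
    obtain ⟨t, ⟨e⟩⟩ := Finite.exists_equiv_fin F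
    refine ⟨t, fun k => (e.symm k : Matrix (Fin 4) (Fin 4) ℤ), fun L hL h1 h2 => ?_⟩
    obtain ⟨L', hL', hiso⟩ := hF' L hL h1 h2
    exact ⟨e ⟨L', hL'⟩, by simpa using hiso⟩
end

section
/- For any finite list L₁,…,L_t of positive definite integral quaternary quadratic forms, there exist infinitely many pairwise non-isometric positive definite integral binary quadratic forms ℓ such that ℓ is not represented by L_i for any i with 1 ≤ i ≤ t. -/
open Matrix

lemma binary_odd (p A B C s : ℤ) (hp : Prime p) (h2 : IsCoprime 2 p) (hs : p ∣ s)
    (h : p ^ 5 ∣ B ^ 2 - 4 * A * C - s ^ 2) :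
    ∃ X Y : ℤ, ¬ (p ∣ X ∧ p ∣ Y) ∧ p ^ 2 ∣ A * X ^ 2 + B * X * Y + C * Y ^ 2 ∧
      p ∣ 2 * A * X + B * Y ∧ p ∣ B * X + 2 * C * Y := by
  obtain ⟨s', rfl⟩ := hs
  obtain ⟨k, hk⟩ := h
  have key : ∀ A C : ℤ, B ^ 2 - 4 * A * C - (p * s') ^ 2 = p ^ 5 * k → ¬ p ∣ A →
      ∃ X : ℤ, p ^ 2 ∣ A * X ^ 2 + B * X + C ∧ p ∣ 2 * A * X + B ∧ p ∣ B * X + 2 * C := by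
    intro A C hk hA
    have hcA : IsCoprime A p := ((Prime.coprime_iff_not_dvd hp).2 hA).symm
    have hc : IsCoprime (2 * A) (p ^ 2) := (IsCoprime.mul_left h2 hcA).pow_right
    obtain ⟨u, v, huv⟩ := hc
    refine ⟨-u * B, ?_, ?_, ?_⟩
    · have hc4 : IsCoprime (p ^ 2) (4 * A) := by
        have : IsCoprime (2 * (2 * A)) (p ^ 2) :=
          (IsCoprime.mul_left h2 (IsCoprime.mul_left h2 hcA)).pow_right
        have e : 4 * A = 2 * (2 * A) := by ring
        rw [e]; exact this.symm
      apply hc4.dvd_of_dvd_mul_left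
      have e1 : 1 - u * (2 * A) = v * p ^ 2 := by linarith
      have : 4 * A * (A * (-u * B) ^ 2 + B * (-u * B) + C) =
        (B * (1 - u * (2 * A))) ^ 2 - (B ^ 2 - 4 * A * C) := by ring
      rw [this, e1]
      exact ⟨(B * v) ^ 2 * p ^ 2 - (s' ^ 2 + p ^ 3 * k), by linear_combination -hk⟩
    · exact ⟨B * v * p, by linear_combination -B * huv⟩
    · have hc1 : IsCoprime p (2 * A) := (IsCoprime.mul_left h2 hcA).symm
      apply hc1.dvd_of_dvd_mul_left
      exact ⟨B * (B * v * p) - p * (s' ^ 2 + p ^ 3 * k), by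
        linear_combination -B ^ 2 * huv - hk⟩
  by_cases hA : p ∣ A
  · by_cases hC : p ∣ C
    · obtain ⟨A', rfl⟩ := hA
      obtain ⟨C', rfl⟩ := hC
      have hB : p ∣ B := by
        apply hp.dvd_of_dvd_pow (n := 2)
        exact ⟨4 * A' * p * C' + p * s' ^ 2 + p ^ 4 * k, by linear_combination hk⟩
      obtain ⟨B', rfl⟩ := hB
      have hk' : B' ^ 2 - 4 * A' * C' - s' ^ 2 = p ^ 3 * k := by
        have : p ^ 2 * (B' ^ 2 - 4 * A' * C' - s' ^ 2) = p ^ 2 * (p ^ 3 * k) := by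
          linear_combination hk
        exact mul_left_cancel₀ (pow_ne_zero 2 hp.ne_zero) this
      by_cases hA' : p ∣ A'
      · obtain ⟨A₂, rfl⟩ := hA'
        exact ⟨1, 0, fun h => hp.not_isUnit (isUnit_of_dvd_one h.1), ⟨A₂, by ring⟩,
          ⟨2 * (p * A₂), by ring⟩, ⟨B', by ring⟩⟩
      · have hcA : IsCoprime A' p := ((Prime.coprime_iff_not_dvd hp).2 hA').symm
        obtain ⟨u, v, huv⟩ := IsCoprime.mul_left h2 hcA
        refine ⟨u * (-B' + s'), 1, fun h => hp.not_isUnit (isUnit_of_dvd_one h.2), ?_,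
          ⟨2 * A' * (u * (-B' + s')) + B', by ring⟩, ⟨B' * (u * (-B' + s')) + 2 * C', by ring⟩⟩
        have hc4 : IsCoprime p (2 * (2 * A')) :=
          (IsCoprime.mul_left h2 (IsCoprime.mul_left h2 hcA)).symm
        have : p ∣ A' * (u * (-B' + s')) ^ 2 + B' * (u * (-B' + s')) + C' := by
          apply hc4.dvd_of_dvd_mul_left
          have e1 : 2 * A' * u = 1 - v * p := by linarith
          have : 2 * (2 * A') * (A' * (u * (-B' + s')) ^ 2 + B' * (u * (-B' + s')) + C') =
            ((2 * A' * u) * (-B' + s') + B') ^ 2 - (B' ^ 2 - 4 * A' * C') := by ring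
          rw [this, e1]
          exact ⟨v ^ 2 * p * (-B' + s') ^ 2 - 2 * s' * v * (-B' + s') - p ^ 2 * k,
            by linear_combination -hk'⟩
        obtain ⟨m, hm⟩ := this
        exact ⟨m, by linear_combination p * hm⟩
    · obtain ⟨X, h1, h2, h3⟩ := key C A (by linarith) hC
      refine ⟨1, X, fun h => hp.not_isUnit (isUnit_of_dvd_one h.1), ?_, ?_, ?_⟩
      · convert h1 using 1; ring
      · convert h3 using 1; ring
      · convert h2 using 1; ring
  · obtain ⟨X, h1, h2, h3⟩ := key A C hk hA
    refine ⟨X, 1, fun h => hp.not_isUnit (isUnit_of_dvd_one h.2), ?_, ?_, ?_⟩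
    · convert h1 using 1; ring
    · convert h2 using 1; ring
    · convert h3 using 1; ring

lemma binary_two (A B C s : ℤ) (hs : 2 ∣ s)
    (h : 2 ^ 5 ∣ B ^ 2 - 4 * A * C - s ^ 2) :
    ∃ X Y : ℤ, ¬ (2 ∣ X ∧ 2 ∣ Y) ∧ 2 ^ 2 ∣ A * X ^ 2 + B * X * Y + C * Y ^ 2 ∧
      2 ∣ 2 * A * X + B * Y ∧ 2 ∣ B * X + 2 * C * Y := by
  obtain ⟨s', rfl⟩ := hs
  obtain ⟨k, hk⟩ := h
  have hB : (2 : ℤ) ∣ B := by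
    apply Int.prime_two.dvd_of_dvd_pow (n := 2)
    exact ⟨2 * A * C + 2 * s' ^ 2 + 16 * k, by linear_combination hk⟩
  obtain ⟨b, rfl⟩ := hB
  have hk' : b ^ 2 - A * C - s' ^ 2 = 8 * k := by linarith
  suffices ∃ X Y : ℤ, ¬ (2 ∣ X ∧ 2 ∣ Y) ∧ 2 ^ 2 ∣ A * X ^ 2 + 2 * b * X * Y + C * Y ^ 2 by
    obtain ⟨X, Y, h1, h2⟩ := this
    exact ⟨X, Y, h1, h2, ⟨A * X + b * Y, by ring⟩, ⟨b * X + C * Y, by ring⟩⟩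
  have key : ∀ A C : ℤ, b ^ 2 - A * C - s' ^ 2 = 8 * k → ¬ 2 ∣ A →
      ∃ X : ℤ, 2 ^ 2 ∣ A * X ^ 2 + 2 * b * X + C := by
    intro A C hk hA
    have hcA : IsCoprime A (2 ^ 2) :=
      ((Prime.coprime_iff_not_dvd Int.prime_two).2 hA).symm.pow_right
    obtain ⟨u, v, huv⟩ := id hcA
    refine ⟨u * (-b + s'), ?_⟩
    apply hcA.symm.dvd_of_dvd_mul_left
    have e1 : A * u = 1 - v * 2 ^ 2 := by linarith
    have : A * (A * (u * (-b + s')) ^ 2 + 2 * b * (u * (-b + s')) + C) =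
      ((A * u) * (-b + s') + b) ^ 2 - (b ^ 2 - A * C) := by ring
    rw [this, e1]
    exact ⟨4 * v ^ 2 * (-b + s') ^ 2 - 2 * s' * v * (-b + s') - 2 * k,
      by linear_combination -hk⟩
  by_cases hA : 2 ∣ A
  · by_cases hC : 2 ∣ C
    · obtain ⟨a, rfl⟩ := hA
      obtain ⟨c, rfl⟩ := hC
      rcases Int.even_or_odd' a with ⟨a', rfl | rfl⟩
      · exact ⟨1, 0, by omega, ⟨a', by ring⟩⟩
      rcases Int.even_or_odd' c with ⟨c', rfl | rfl⟩
      · exact ⟨0, 1, by omega, ⟨c', by ring⟩⟩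
      rcases Int.even_or_odd' b with ⟨b', rfl | rfl⟩
      · exact ⟨1, 1, by omega, ⟨a' + c' + 1 + b', by ring⟩⟩
      exfalso
      rcases Int.even_or_odd' s' with ⟨s, rfl | rfl⟩
      · ring_nf at hk'; omega
      · obtain ⟨x, hx⟩ := Int.even_mul_succ_self b'
        obtain ⟨y, hy⟩ := Int.even_mul_succ_self s
        have : 4 * (x + x) - 4 * (y + y) - 4 * (4 * (a' * c') + 2 * a' + 2 * c' + 1) = 8 * k := by
          rw [← hx, ← hy]; linear_combination hk'
        omega
    · obtain ⟨X, h⟩ := key C A (by linarith) hC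
      exact ⟨1, X, by omega, by convert h using 1; ring⟩
  · obtain ⟨X, h⟩ := key A C hk' hA
    exact ⟨X, 1, by omega, by convert h using 1; ring⟩

lemma binary_step (p : ℕ) (hp : p.Prime) (A B C s : ℤ) (hs : (p : ℤ) ∣ s)
    (h : (p : ℤ) ^ 5 ∣ B ^ 2 - 4 * A * C - s ^ 2) :
    ∃ X Y : ℤ, ¬ ((p : ℤ) ∣ X ∧ (p : ℤ) ∣ Y) ∧ (p : ℤ) ^ 2 ∣ A * X ^ 2 + B * X * Y + C * Y ^ 2 ∧
      (p : ℤ) ∣ 2 * A * X + B * Y ∧ (p : ℤ) ∣ B * X + 2 * C * Y := by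
  rcases hp.eq_two_or_odd' with rfl | hodd
  · exact binary_two A B C s hs h
  · exact binary_odd p A B C s (Nat.prime_iff_prime_int.1 hp)
      (by have := Nat.coprime_two_left.2 hodd; exact_mod_cast this.isCoprime) hs h

/-- Rank four step in adapted coordinates. -/
lemma quaternary_step (p : ℕ) (hp : p.Prime) (a b c d u e f g h k n a₀ b₀ c₀ d₀ : ℤ)
    (ha : a = 2 * p ^ 5 * a₀) (hb : b = 2 * b₀) (hc : c = 2 * c₀) (hd : d = 2 * d₀)
    (hu : ¬ (p : ℤ) ∣ u) (hn : (p : ℤ) ∣ n)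
    (hdet : (!![a, u, e, f; u, b, g, h; e, g, c, k; f, h, k, d]).det = n ^ 2) :
    ∃ v : Fin 4 → ℤ, (∃ i, ¬ (p : ℤ) ∣ v i) ∧
      2 * (p : ℤ) ^ 2 ∣ v ⬝ᵥ (!![a, u, e, f; u, b, g, h; e, g, c, k; f, h, k, d] *ᵥ v) ∧
      ∀ i, (p : ℤ) ∣ (!![a, u, e, f; u, b, g, h; e, g, c, k; f, h, k, d] *ᵥ v) i := by
  have hpp : Prime (p : ℤ) := Nat.prime_iff_prime_int.1 hp
  set Δ := u ^ 2 - a * b with hΔ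
  have hpΔ : ¬ (p : ℤ) ∣ Δ := by
    intro hh
    apply hu
    apply hpp.dvd_of_dvd_pow (n := 2)
    have : u ^ 2 = Δ + p * (2 * p ^ 4 * a₀ * b) := by rw [hΔ, ha]; ring
    rw [this]
    exact dvd_add hh ⟨_, rfl⟩
  obtain ⟨X, Y, h1, ⟨m, hm⟩, ⟨m1, hm1⟩, ⟨m2, hm2⟩⟩ := binary_step p hp
    (Δ * c₀ + b₀ * e ^ 2 - u * g * e + p ^ 5 * a₀ * g ^ 2)
    (Δ * k + (e * b - g * u) * f + (a * g - u * e) * h)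
    (Δ * d₀ + b₀ * f ^ 2 - u * h * f + p ^ 5 * a₀ * h ^ 2) (u * n) (Dvd.dvd.mul_left hn u) (by
      have : (Δ * k + (e * b - g * u) * f + (a * g - u * e) * h) ^ 2 -
         4 * (Δ * c₀ + b₀ * e ^ 2 - u * g * e + p ^ 5 * a₀ * g ^ 2) *
         (Δ * d₀ + b₀ * f ^ 2 - u * h * f + p ^ 5 * a₀ * h ^ 2) = Δ * n ^ 2 := by
        rw [← hdet, hΔ, Matrix.det_succ_row_zero]
        simp [Fin.sum_univ_succ, Matrix.det_fin_three, Fin.succAbove]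
        subst ha hb hc hd
        ring
      rw [this, hΔ, ha]
      exact ⟨-(2 * a₀ * b * n ^ 2), by ring⟩)
  refine ⟨![X * (e * b - g * u) + Y * (f * b - h * u), X * (a * g - u * e) + Y * (a * h - u * f),
    Δ * X, Δ * Y], ?_, ?_, ?_⟩
  · by_contra hcon
    push Not at hcon
    exact h1 ⟨(hpp.dvd_or_dvd (hcon 2)).resolve_left hpΔ,
      (hpp.dvd_or_dvd (hcon 3)).resolve_left hpΔ⟩
  · refine ⟨Δ * m, ?_⟩
    have : 2 * (p : ℤ) ^ 2 * (Δ * m) = 2 * Δ * (p ^ 2 * m) := by ring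
    rw [this, ← hm]
    simp [Matrix.mulVec, dotProduct, Fin.sum_univ_succ]
    subst ha hb hc hd
    rw [hΔ]
    ring
  · intro i
    fin_cases i
    · refine ⟨0, ?_⟩
      simp [Matrix.mulVec, dotProduct, Fin.sum_univ_succ]
      rw [hΔ]; ring
    · refine ⟨0, ?_⟩
      simp [Matrix.mulVec, dotProduct, Fin.sum_univ_succ]
      rw [hΔ]; ring
    · refine ⟨m1, ?_⟩
      rw [← hm1]
      simp [Matrix.mulVec, dotProduct, Fin.sum_univ_succ]
      subst ha hb hc hd
      ring
    · refine ⟨m2, ?_⟩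
      rw [← hm2]
      simp [Matrix.mulVec, dotProduct, Fin.sum_univ_succ]
      subst ha hb hc hd
      ring

lemma dvd_dot (p : ℤ) (y w : Fin 4 → ℤ) (h : ∀ i, p ∣ w i) : p ∣ y ⬝ᵥ w :=
  Finset.dvd_sum fun j _ => Dvd.dvd.mul_left (h j) _

lemma pow_dvd_of_mul (p : ℤ) (hp : Prime p) (k n : ℕ) (d x : ℤ) (h : p ^ (k + n) ∣ d * x)
    (hd : ¬ p ^ n ∣ d) : p ^ k ∣ x := by
  induction n generalizing d with
  | zero => simp at hd
  | succ n ih =>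
    by_cases hpd : p ∣ d
    · obtain ⟨d', rfl⟩ := hpd
      apply ih d'
      · rw [← add_assoc, pow_succ', mul_assoc] at h
        exact (mul_dvd_mul_iff_left hp.ne_zero).1 h
      · intro h'
        apply hd
        rw [pow_succ']
        exact mul_dvd_mul_left _ h'
    · exact hp.pow_dvd_of_dvd_mul_left _ hpd (dvd_trans (pow_dvd_pow _ (by omega)) h)

lemma vec_dvd_of_mulVec (p : ℤ) (hp : Prime p) (T : Matrix (Fin 4) (Fin 4) ℤ) (hT : ¬ p ∣ T.det)
    (w : Fin 4 → ℤ) (h : ∀ i, p ∣ (T *ᵥ w) i) : ∀ i, p ∣ w i := by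
  intro i
  have h1 : T.adjugate *ᵥ (T *ᵥ w) = T.det • w := by
    rw [Matrix.mulVec_mulVec, Matrix.adjugate_mul, Matrix.smul_mulVec, Matrix.one_mulVec]
  have h2 : p ∣ T.det * w i := by
    have : T.det * w i = (T.adjugate *ᵥ (T *ᵥ w)) i := by rw [h1]; simp
    rw [this]
    exact dvd_dot _ _ _ h
  exact (hp.dvd_or_dvd h2).resolve_left hT

lemma even_value (G : Matrix (Fin 4) (Fin 4) ℤ) (hs : G.IsSymm) (he : ∀ i, 2 ∣ G i i)
    (y : Fin 4 → ℤ) : 2 ∣ y ⬝ᵥ (G *ᵥ y) := by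
  have h10 := hs.apply 0 1
  have h20 := hs.apply 0 2
  have h30 := hs.apply 0 3
  have h21 := hs.apply 1 2
  have h31 := hs.apply 1 3
  have h32 := hs.apply 2 3
  obtain ⟨a, ha⟩ := he 0
  obtain ⟨b, hb⟩ := he 1
  obtain ⟨c, hc⟩ := he 2
  obtain ⟨d, hd⟩ := he 3
  simp only [Matrix.mulVec, dotProduct, Fin.sum_univ_four]
  rw [h10, h20, h30, h21, h31, h32, ha, hb, hc, hd]
  exact ⟨a * y 0 ^ 2 + b * y 1 ^ 2 + c * y 2 ^ 2 + d * y 3 ^ 2 + G 0 1 * y 0 * y 1 +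
    G 0 2 * y 0 * y 2 + G 0 3 * y 0 * y 3 + G 1 2 * y 1 * y 2 + G 1 3 * y 1 * y 3 +
    G 2 3 * y 2 * y 3, by ring⟩

lemma conj_apply' {m n : ℕ} (G : Matrix (Fin m) (Fin m) ℤ) (T : Matrix (Fin m) (Fin n) ℤ)
    (a b : Fin n) : (Tᵀ * G * T) a b = (fun k => T k a) ⬝ᵥ (G *ᵥ fun k => T k b) := by
  rw [Matrix.mul_assoc, Matrix.mul_apply]
  rfl

lemma conj_value {m n : ℕ} (G : Matrix (Fin m) (Fin m) ℤ) (T : Matrix (Fin m) (Fin n) ℤ)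
    (x : Fin n → ℤ) : x ⬝ᵥ ((Tᵀ * G * T) *ᵥ x) = (T *ᵥ x) ⬝ᵥ (G *ᵥ (T *ᵥ x)) := by
  rw [Matrix.mul_assoc, ← Matrix.mulVec_mulVec, ← Matrix.mulVec_mulVec, Matrix.dotProduct_mulVec,
    Matrix.vecMul_transpose]

lemma symm_conj {m n : ℕ} (G : Matrix (Fin m) (Fin m) ℤ) (T : Matrix (Fin m) (Fin n) ℤ)
    (hs : G.IsSymm) : (Tᵀ * G * T).IsSymm := by
  unfold Matrix.IsSymm
  rw [Matrix.transpose_mul, Matrix.transpose_mul, Matrix.transpose_transpose, hs.eq,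
    Matrix.mul_assoc]

lemma det_updateCol_one (i : Fin 4) (x : Fin 4 → ℤ) :
    ((1 : Matrix (Fin 4) (Fin 4) ℤ).updateCol i x).det = x i := by
  rw [← Matrix.cramer_apply, Matrix.cramer_one]; rfl

lemma exists_v (p : ℕ) (hp : p.Prime) (G : Matrix (Fin 4) (Fin 4) ℤ) (hs : G.IsSymm)
    (he : ∀ i, 2 ∣ G i i) (D : ℤ) (hD : G.det = D ^ 2) (hpD : (p : ℤ) ∣ D)
    (x : Fin 4 → ℤ) (hx : ∃ i, ¬ (p : ℤ) ∣ x i) (hQ : 2 * (p : ℤ) ^ 5 ∣ x ⬝ᵥ (G *ᵥ x)) :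
    ∃ v : Fin 4 → ℤ, (∃ i, ¬ (p : ℤ) ∣ v i) ∧ 2 * (p : ℤ) ^ 2 ∣ v ⬝ᵥ (G *ᵥ v) ∧
      ∀ i, (p : ℤ) ∣ (G *ᵥ v) i := by
  have hpp : Prime (p : ℤ) := Nat.prime_iff_prime_int.1 hp
  by_cases h : ∀ j, (p : ℤ) ∣ (G *ᵥ x) j
  · exact ⟨x, hx, dvd_trans ⟨(p : ℤ) ^ 3, by ring⟩ hQ, h⟩
  push Not at h
  obtain ⟨j, hj⟩ := h
  have : ∃ i, i ≠ j ∧ ¬ (p : ℤ) ∣ x i := by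
    by_contra hcon
    push Not at hcon
    have h1 : (p : ℤ) ∣ x j * (G *ᵥ x) j := by
      have h2 : x ⬝ᵥ (G *ᵥ x) = x j * (G *ᵥ x) j + ∑ i ∈ {j}ᶜ, x i * (G *ᵥ x) i :=
        Fintype.sum_eq_add_sum_compl j _
      have h3 : (p : ℤ) ∣ ∑ i ∈ {j}ᶜ, x i * (G *ᵥ x) i :=
        Finset.dvd_sum fun i hi => Dvd.dvd.mul_right (hcon i (by simpa using hi)) _
      have h4 : (p : ℤ) ∣ x ⬝ᵥ (G *ᵥ x) := dvd_trans ⟨2 * (p : ℤ) ^ 4, by ring⟩ hQ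
      rw [h2] at h4
      exact (dvd_add_left h3).1 h4
    have h5 := (hpp.dvd_or_dvd h1).resolve_right hj
    obtain ⟨i, hi⟩ := hx
    by_cases hij : i = j
    · exact hi (hij ▸ h5)
    · exact hi (hcon i hij)
  obtain ⟨i, hij, hi⟩ := this
  have hσ : ∀ i j : Fin 4, i ≠ j → ∃ σ : Equiv.Perm (Fin 4), σ 0 = i ∧ σ 1 = j := by decide
  obtain ⟨σ, hσ0, hσ1⟩ := hσ i j hij
  set T : Matrix (Fin 4) (Fin 4) ℤ :=
    ((1 : Matrix (Fin 4) (Fin 4) ℤ).updateCol i x).submatrix id σ with hT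
  have hTdet : T.det = ((Equiv.Perm.sign σ : ℤˣ) : ℤ) * x i := by
    rw [hT, Matrix.det_permute', det_updateCol_one]; rfl
  have hTp : ¬ (p : ℤ) ∣ T.det := by
    rw [hTdet]
    rcases Int.units_eq_one_or (Equiv.Perm.sign σ) with h | h <;> simp [h, hi]
  have hc0 : (fun k => T k 0) = x := by
    funext k; simp [hT, hσ0]
  have hc1 : (fun k => T k 1) = Pi.single j 1 := by
    funext k
    simp [hT, hσ1, hij.symm, Matrix.one_apply, Pi.single_apply]
  set G2 := Tᵀ * G * T with hG2
  have hsym : G2.IsSymm := symm_conj G T hs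
  have hdiag : ∀ a, 2 ∣ G2 a a := fun a => by
    rw [hG2, conj_apply']; exact even_value G hs he _
  have h00 : 2 * (p : ℤ) ^ 5 ∣ G2 0 0 := by rw [hG2, conj_apply', hc0]; exact hQ
  have h01 : ¬ (p : ℤ) ∣ G2 0 1 := by
    rw [← hsym.apply 0 1, hG2, conj_apply', hc0, hc1, single_dotProduct, one_mul]; exact hj
  have hdet : G2.det = (T.det * D) ^ 2 := by
    rw [hG2, Matrix.det_mul, Matrix.det_mul, Matrix.det_transpose, hD]; ring
  have hform : G2 = !![G2 0 0, G2 0 1, G2 0 2, G2 0 3; G2 0 1, G2 1 1, G2 1 2, G2 1 3;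
      G2 0 2, G2 1 2, G2 2 2, G2 2 3; G2 0 3, G2 1 3, G2 2 3, G2 3 3] := by
    have h10 := hsym.apply 0 1
    have h20 := hsym.apply 0 2
    have h30 := hsym.apply 0 3
    have h21 := hsym.apply 1 2
    have h31 := hsym.apply 1 3
    have h32 := hsym.apply 2 3
    clear_value G2
    ext a b
    fin_cases a <;> fin_cases b <;> first | rfl | assumption
  obtain ⟨a₀, ha₀⟩ := h00
  obtain ⟨b₀, hb₀⟩ := hdiag 1
  obtain ⟨c₀, hc₀⟩ := hdiag 2
  obtain ⟨d₀, hd₀⟩ := hdiag 3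
  obtain ⟨w, hw1, hw2, hw3⟩ := quaternary_step p hp (G2 0 0) (G2 1 1) (G2 2 2) (G2 3 3) (G2 0 1)
    (G2 0 2) (G2 0 3) (G2 1 2) (G2 1 3) (G2 2 3) (T.det * D) a₀ b₀ c₀ d₀ ha₀ hb₀ hc₀ hd₀ h01
    (Dvd.dvd.mul_left hpD _) (by rw [← hform]; exact hdet)
  rw [← hform] at hw2 hw3
  refine ⟨T *ᵥ w, ?_, ?_, ?_⟩
  · by_contra hcon
    push Not at hcon
    obtain ⟨l, hl⟩ := hw1
    exact hl (vec_dvd_of_mulVec p hpp T hTp w hcon l)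
  · rw [← conj_value]; exact hw2
  · apply vec_dvd_of_mulVec p hpp Tᵀ (by rwa [Matrix.det_transpose])
    rwa [Matrix.mulVec_mulVec, Matrix.mulVec_mulVec]

lemma symm_dot (G : Matrix (Fin 4) (Fin 4) ℤ) (hs : G.IsSymm) (x y : Fin 4 → ℤ) :
    x ⬝ᵥ (G *ᵥ y) = y ⬝ᵥ (G *ᵥ x) := by
  rw [Matrix.dotProduct_mulVec, ← Matrix.mulVec_transpose, hs.eq, dotProduct_comm]

lemma normalize_v (p : ℕ) (hp : p.Prime) (G : Matrix (Fin 4) (Fin 4) ℤ) (hs : G.IsSymm)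
    (he : ∀ i, 2 ∣ G i i) (v : Fin 4 → ℤ) (hv : ∃ i, ¬ (p : ℤ) ∣ v i)
    (hQ : 2 * (p : ℤ) ^ 2 ∣ v ⬝ᵥ (G *ᵥ v)) (hG : ∀ i, (p : ℤ) ∣ (G *ᵥ v) i) :
    ∃ v : Fin 4 → ℤ, (∃ i, v i = 1) ∧ 2 * (p : ℤ) ^ 2 ∣ v ⬝ᵥ (G *ᵥ v) ∧
      ∀ i, (p : ℤ) ∣ (G *ᵥ v) i := by
  have hpp : Prime (p : ℤ) := Nat.prime_iff_prime_int.1 hp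
  obtain ⟨i, hi⟩ := hv
  obtain ⟨h, k, hk⟩ : IsCoprime (v i) ((p : ℤ) ^ 2) :=
    ((Prime.coprime_iff_not_dvd hpp).2 hi).symm.pow_right
  refine ⟨h • v + ((p : ℤ) ^ 2 * k) • Pi.single i 1, ⟨i, ?_⟩, ?_, ?_⟩
  · simp; linarith
  · obtain ⟨m, hm⟩ := hQ
    obtain ⟨c, hc⟩ := even_value G hs he (Pi.single i 1)
    have := symm_dot G hs (Pi.single i 1) v
    refine ⟨h ^ 2 * m + h * k * (v ⬝ᵥ (G *ᵥ Pi.single i 1)) + p ^ 2 * k ^ 2 * c, ?_⟩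
    simp only [Matrix.mulVec_add, Matrix.mulVec_smul, dotProduct_add, add_dotProduct,
      smul_dotProduct, dotProduct_smul, smul_eq_mul, hm, hc, this]
    ring
  · intro j
    rw [Matrix.mulVec_add, Matrix.mulVec_smul, Matrix.mulVec_smul]
    simp only [Pi.add_apply, Pi.smul_apply, smul_eq_mul]
    exact dvd_add (Dvd.dvd.mul_left (hG j) _) ⟨p * k * (G *ᵥ Pi.single i 1) j, by ring⟩

lemma overlattice (p : ℕ) (hp : p.Prime) (G : Matrix (Fin 4) (Fin 4) ℤ) (hs : G.IsSymm)
    (he : ∀ i, 2 ∣ G i i) (D : ℤ) (hD : G.det = D ^ 2)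
    (v : Fin 4 → ℤ) (hv : ∃ i, v i = 1)
    (hQ : 2 * (p : ℤ) ^ 2 ∣ v ⬝ᵥ (G *ᵥ v)) (hG : ∀ i, (p : ℤ) ∣ (G *ᵥ v) i) :
    ∃ (G' P : Matrix (Fin 4) (Fin 4) ℤ) (D' : ℤ), G'.IsSymm ∧ (∀ i, 2 ∣ G' i i) ∧ P.det ≠ 0 ∧
      G = Pᵀ * G' * P ∧ D = p * D' ∧ G'.det = D' ^ 2 := by
  have hp0 : (p : ℤ) ≠ 0 := by exact_mod_cast hp.ne_zero
  obtain ⟨i, hi⟩ := hv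
  set U : Matrix (Fin 4) (Fin 4) ℤ := (1 : Matrix (Fin 4) (Fin 4) ℤ).updateCol i v with hU
  have hUdet : U.det = 1 := by rw [hU, det_updateCol_one, hi]
  have hci : (fun k => U k i) = v := by funext k; simp [hU]
  set G1 := Uᵀ * G * U with hG1
  have hsym : G1.IsSymm := symm_conj G U hs
  have hdiag : ∀ a, 2 ∣ G1 a a := fun a => by
    rw [hG1, conj_apply']; exact even_value G hs he _
  have hrow : ∀ b, (p : ℤ) ∣ G1 b i := fun b => by
    rw [hG1, conj_apply', hci]
    exact Finset.dvd_sum fun j _ => Dvd.dvd.mul_left (hG j) _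
  have hii : 2 * (p : ℤ) ^ 2 ∣ G1 i i := by rw [hG1, conj_apply', hci]; exact hQ
  have hdet : G1.det = D ^ 2 := by
    rw [hG1, Matrix.det_mul, Matrix.det_mul, Matrix.det_transpose, hD, hUdet]; ring
  set E : Fin 4 → ℤ := fun a => if a = i then (p : ℤ) else 1 with hE
  have hE0 : ∀ a, E a ≠ 0 := fun a => by
    simp only [hE]; split_ifs; exacts [hp0, one_ne_zero]
  have hdvd : ∀ a b, ∃ c, G1 a b = E a * c * E b := by
    intro a b
    by_cases ha : a = i
    · by_cases hb : b = i
      · subst ha; subst hb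
        obtain ⟨c, hc⟩ := hii
        exact ⟨2 * c, by simp only [hE, if_true]; rw [hc]; ring⟩
      · obtain ⟨c, hc⟩ := hrow b
        rw [hsym.apply] at hc
        exact ⟨c, by rw [ha]; simp [hE, hb, hc]⟩
    · by_cases hb : b = i
      · obtain ⟨c, hc⟩ := hrow a
        exact ⟨c, by rw [hb]; simp [hE, ha, hc, mul_comm]⟩
      · exact ⟨G1 a b, by simp [hE, ha, hb]⟩
  choose G' hG' using hdvd
  have hfac : G1 = (Matrix.diagonal E) * (Matrix.of G') * (Matrix.diagonal E) := by
    ext a b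
    rw [Matrix.mul_diagonal, Matrix.diagonal_mul, hG']; rfl
  have hEdet : (Matrix.diagonal E).det = p := by
    rw [Matrix.det_diagonal, hE, Finset.prod_ite_eq']; simp
  have hUU : U * U⁻¹ = 1 := Matrix.mul_nonsing_inv U (by rw [hUdet]; exact isUnit_one)
  have hdG : D ^ 2 = (p : ℤ) ^ 2 * (Matrix.of G').det := by
    rw [← hdet, hfac, Matrix.det_mul, Matrix.det_mul, hEdet]; ring
  obtain ⟨D', hD'⟩ : (p : ℤ) ∣ D := (Int.pow_dvd_pow_iff two_ne_zero).1 ⟨_, hdG⟩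
  refine ⟨Matrix.of G', Matrix.diagonal E * U⁻¹, D', ?_, ?_, ?_, ?_, hD', ?_⟩
  · ext a b
    have h1 := hG' a b
    have h2 := hG' b a
    rw [hsym.apply, h1] at h2
    have h3 : E a * (E b * G' a b) = E a * (E b * G' b a) := by linear_combination h2
    exact (mul_left_cancel₀ (hE0 b) (mul_left_cancel₀ (hE0 a) h3)).symm
  · intro a
    show 2 ∣ G' a a
    by_cases ha : a = i
    · subst ha
      obtain ⟨c, hc⟩ := hii
      rw [hG'] at hc
      simp only [hE, if_true] at hc
      refine ⟨c, ?_⟩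
      have : (p : ℤ) ^ 2 * G' a a = p ^ 2 * (2 * c) := by linear_combination hc
      exact mul_left_cancel₀ (pow_ne_zero 2 hp0) this
    · have := hdiag a
      rw [hG'] at this
      simpa [hE, ha] using this
  · rw [Matrix.det_mul, hEdet]
    apply mul_ne_zero hp0
    intro h
    have := congrArg Matrix.det hUU
    rw [Matrix.det_mul, h] at this
    simp at this
  · have : G = (U * U⁻¹)ᵀ * G * (U * U⁻¹) := by rw [hUU]; simp
    rw [this, Matrix.transpose_mul, Matrix.transpose_mul, Matrix.diagonal_transpose]
    have h2 : U⁻¹ᵀ * Uᵀ * G * (U * U⁻¹) = U⁻¹ᵀ * G1 * U⁻¹ := by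
      rw [hG1]; simp only [Matrix.mul_assoc]
    rw [h2, hfac]; simp only [Matrix.mul_assoc]
  · rw [hD'] at hdG
    have : (p : ℤ) ^ 2 * (Matrix.of G').det = p ^ 2 * D' ^ 2 := by linear_combination -hdG
    exact mul_left_cancel₀ (pow_ne_zero 2 hp0) this

/-- anisotropy at `p`, in a finite form -/
def AnisoAt (p : ℕ) (G : Matrix (Fin 4) (Fin 4) ℤ) : Prop :=
  ∀ k : ℕ, ∃ e : ℕ, ∀ x : Fin 4 → ℤ, (p : ℤ) ^ e ∣ x ⬝ᵥ (G *ᵥ x) → ∀ i, (p : ℤ) ^ k ∣ x i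

lemma aniso_of_one (p : ℕ) (hp : p.Prime) (G : Matrix (Fin 4) (Fin 4) ℤ) (e : ℕ)
    (h : ∀ x : Fin 4 → ℤ, (p : ℤ) ^ e ∣ x ⬝ᵥ (G *ᵥ x) → ∀ i, (p : ℤ) ∣ x i) : AnisoAt p G := by
  have hp0 : (p : ℤ) ≠ 0 := by exact_mod_cast hp.ne_zero
  intro k
  refine ⟨e + 2 * k, ?_⟩
  induction k with
  | zero => intro x _ i; simp
  | succ k ih =>
    intro x hx i
    have h1 := h x (dvd_trans (pow_dvd_pow _ (by omega)) hx)
    choose y hy using h1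
    have hxy : x = (p : ℤ) • y := by funext j; simp [hy j]
    have h2 : (p : ℤ) ^ (e + 2 * k) ∣ y ⬝ᵥ (G *ᵥ y) := by
      rw [hxy, Matrix.mulVec_smul, dotProduct_smul, smul_dotProduct] at hx
      have e1 : (p : ℤ) ^ (e + 2 * (k + 1)) = p ^ 2 * p ^ (e + 2 * k) := by ring
      have e2 : (p : ℤ) • (p : ℤ) • (y ⬝ᵥ (G *ᵥ y)) = p ^ 2 * (y ⬝ᵥ (G *ᵥ y)) := by
        simp only [smul_eq_mul]; ring
      rw [e1, e2] at hx
      exact (mul_dvd_mul_iff_left (pow_ne_zero 2 hp0)).1 hx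
    rw [hy i, pow_succ']
    exact mul_dvd_mul_left _ (ih y h2 i)

lemma aniso_transfer (p : ℕ) (hp : p.Prime) (G' P : Matrix (Fin 4) (Fin 4) ℤ) (hP : P.det ≠ 0)
    (h : AnisoAt p G') : AnisoAt p (Pᵀ * G' * P) := by
  have hpp : Prime (p : ℤ) := Nat.prime_iff_prime_int.1 hp
  intro k
  obtain ⟨n, hn⟩ : ∃ n, ¬ (p : ℤ) ^ n ∣ P.det := by
    obtain ⟨n, hn⟩ := FiniteMultiplicity.of_not_isUnit hpp.not_isUnit hP
    exact ⟨n + 1, hn⟩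
  obtain ⟨e, he⟩ := h (k + n)
  refine ⟨e, fun x hx i => ?_⟩
  rw [conj_value] at hx
  have h1 := he _ hx
  have h2 : P.adjugate *ᵥ (P *ᵥ x) = P.det • x := by
    rw [Matrix.mulVec_mulVec, Matrix.adjugate_mul, Matrix.smul_mulVec, Matrix.one_mulVec]
  have h3 : (p : ℤ) ^ (k + n) ∣ P.det * x i := by
    have : P.det * x i = (P.adjugate *ᵥ (P *ᵥ x)) i := by rw [h2]; simp
    rw [this]
    exact dvd_dot _ _ _ h1
  exact pow_dvd_of_mul p hpp k n _ _ h3 hn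

lemma pos_transfer (G' P : Matrix (Fin 4) (Fin 4) ℤ) (hP : P.det ≠ 0)
    (h : ∀ x : Fin 4 → ℤ, x ≠ 0 → 0 < x ⬝ᵥ ((Pᵀ * G' * P) *ᵥ x)) :
    ∀ x : Fin 4 → ℤ, x ≠ 0 → 0 < x ⬝ᵥ (G' *ᵥ x) := by
  intro x hx
  have h1 : P *ᵥ (P.adjugate *ᵥ x) = P.det • x := by
    rw [Matrix.mulVec_mulVec, Matrix.mul_adjugate, Matrix.smul_mulVec, Matrix.one_mulVec]
  have h2 := h (P.adjugate *ᵥ x) (by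
    intro h0
    rw [h0, Matrix.mulVec_zero] at h1
    exact (smul_ne_zero hP hx) h1.symm)
  rw [conj_value, h1, Matrix.mulVec_smul, dotProduct_smul, smul_dotProduct, smul_smul,
    smul_eq_mul] at h2
  exact (mul_pos_iff_of_pos_left (mul_self_pos.2 hP)).1 h2

lemma det_ne_zero_of_pos (G : Matrix (Fin 4) (Fin 4) ℤ)
    (h : ∀ x : Fin 4 → ℤ, x ≠ 0 → 0 < x ⬝ᵥ (G *ᵥ x)) : G.det ≠ 0 := by
  intro h0
  obtain ⟨v, hv, hv0⟩ := Matrix.exists_mulVec_eq_zero_iff.2 h0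
  have := h v hv
  rw [hv0] at this
  simp at this

lemma real_nonneg (G : Matrix (Fin 4) (Fin 4) ℤ)
    (h : ∀ x : Fin 4 → ℤ, x ≠ 0 → 0 < x ⬝ᵥ (G *ᵥ x)) (x : Fin 4 → ℝ) :
    0 ≤ x ⬝ᵥ ((G.map (Int.cast : ℤ → ℝ)) *ᵥ x) := by
  have hcl : IsClosed {x : Fin 4 → ℝ | 0 ≤ x ⬝ᵥ ((G.map (Int.cast : ℤ → ℝ)) *ᵥ x)} := by
    apply isClosed_le continuous_const
    simp only [Matrix.mulVec, dotProduct]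
    fun_prop
  have hd : DenseRange (fun q : Fin 4 → ℚ => fun i => (q i : ℝ)) :=
    DenseRange.piMap (fun _ => Rat.denseRange_cast)
  have hnonneg : ∀ y : Fin 4 → ℤ, 0 ≤ y ⬝ᵥ (G *ᵥ y) := fun y => by
    by_cases hy : y = 0
    · simp [hy]
    · exact (h y hy).le
  refine hcl.closure_subset_iff.2 ?_ (hd x)
  rintro _ ⟨q, rfl⟩
  rw [Set.mem_ofPred_eq]
  set N : ℕ := ∏ i, (q i).den with hN
  have hN0 : (0 : ℝ) < N := by
    rw [hN]; exact_mod_cast Finset.prod_pos fun i _ => (q i).den_pos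
  have hm : ∀ i, ∃ m : ℤ, (N : ℝ) * (q i : ℝ) = m := by
    intro i
    obtain ⟨m, hm⟩ := Finset.dvd_prod_of_mem (fun i => (q i).den) (Finset.mem_univ i)
    refine ⟨(q i).num * m, ?_⟩
    have : (N : ℚ) * q i = (((q i).num * m : ℤ) : ℚ) := by
      rw [hN, hm]
      push_cast
      have := Rat.mul_den_eq_num (q i)
      linear_combination (m : ℚ) * this
    exact_mod_cast this
  choose m hm using hm
  have key : (N : ℝ) ^ 2 * ((fun i => (q i : ℝ)) ⬝ᵥ ((G.map (Int.cast : ℤ → ℝ)) *ᵥ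
      fun i => (q i : ℝ))) = ((m ⬝ᵥ (G *ᵥ m) : ℤ) : ℝ) := by
    have : (fun i => (m i : ℝ)) = (N : ℝ) • (fun i => (q i : ℝ)) := by
      funext i; simp [hm i]
    have e2 : ((m ⬝ᵥ (G *ᵥ m) : ℤ) : ℝ) =
        (fun i => (m i : ℝ)) ⬝ᵥ ((G.map (Int.cast : ℤ → ℝ)) *ᵥ (fun i => (m i : ℝ))) := by
      simp [Matrix.mulVec, dotProduct]
    rw [e2, this, Matrix.mulVec_smul, dotProduct_smul, smul_dotProduct, smul_eq_mul, smul_eq_mul]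
    ring
  have h1 : (0 : ℝ) ≤ ((m ⬝ᵥ (G *ᵥ m) : ℤ) : ℝ) := by exact_mod_cast hnonneg m
  rw [← key] at h1
  exact (mul_nonneg_iff_of_pos_left (by positivity)).1 h1

open scoped MatrixOrder Matrix.Norms.L2Operator in
lemma exists_sqrt_matrix (M : Matrix (Fin 4) (Fin 4) ℝ) (h : M.PosSemidef) :
    ∃ B : Matrix (Fin 4) (Fin 4) ℝ, M = Bᵀ * B := by
  have := CStarAlgebra.nonneg_iff_eq_star_mul_self.1 h.nonneg
  obtain ⟨B, hB⟩ := this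
  exact ⟨B, by rw [hB, Matrix.star_eq_conjTranspose, Matrix.conjTranspose_eq_transpose_of_trivial]⟩

lemma volume_sq_lt : (16 : ENNReal) < MeasureTheory.volume {y : Fin 4 → ℝ | ∑ i, y i ^ 2 < 2} := by
  have h1 : {y : Fin 4 → ℝ | ∑ i, y i ^ 2 < 2} =
      (WithLp.toLp 2) ⁻¹' (Metric.ball (0 : EuclideanSpace ℝ (Fin 4)) (√2)) := by
    ext y
    simp only [Set.mem_ofPred_eq, Set.mem_preimage, mem_ball_zero_iff, EuclideanSpace.norm_eq,
      Real.norm_eq_abs, sq_abs]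
    rw [Real.sqrt_lt_sqrt_iff (Finset.sum_nonneg fun i _ => sq_nonneg _)]
  rw [h1, (PiLp.volume_preserving_toLp (Fin 4)).measure_preimage
    measurableSet_ball.nullMeasurableSet,
    InnerProductSpace.volume_ball_of_dim_even (k := 2) (by simp)]
  rw [← ENNReal.ofReal_pow (by positivity), ← ENNReal.ofReal_mul (by positivity)]
  have : (16 : ENNReal) = ENNReal.ofReal 16 := by norm_num
  rw [this, ENNReal.ofReal_lt_ofReal_iff_of_nonneg (by norm_num)]
  have h2 : (√2 : ℝ) ^ 4 = 4 := by
    have := Real.sq_sqrt (show (0 : ℝ) ≤ 2 by norm_num)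
    nlinarith
  simp only [finrank_euclideanSpace, Fintype.card_fin, h2]
  have := Real.pi_gt_three
  simp [Nat.factorial]
  nlinarith

lemma no_even_unimodular (G : Matrix (Fin 4) (Fin 4) ℤ) (hs : G.IsSymm) (he : ∀ i, 2 ∣ G i i)
    (h : ∀ x : Fin 4 → ℤ, x ≠ 0 → 0 < x ⬝ᵥ (G *ᵥ x)) (hdet : G.det = 1) : False := by
  have hpsd : (G.map (Int.cast : ℤ → ℝ)).PosSemidef := by
    refine .of_dotProduct_mulVec_nonneg ?_ fun x => by simpa using real_nonneg G h x
    ext i j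
    simp [hs.apply]
  obtain ⟨B, hB⟩ := exists_sqrt_matrix _ hpsd
  have hBdet : B.det ^ 2 = 1 := by
    have h1 : (G.map (Int.cast : ℤ → ℝ)).det = 1 := by
      have := (Int.castRingHom ℝ).map_det G
      rw [hdet] at this
      simpa using this.symm
    rw [hB, Matrix.det_mul, Matrix.det_transpose] at h1
    rw [sq, h1]
  have hBabs : |B.det| = 1 := by
    rw [← sq_abs] at hBdet
    nlinarith [abs_nonneg B.det]
  have hB0 : B.det ≠ 0 := by
    intro h0; rw [h0] at hBdet; norm_num at hBdet
  have hval : ∀ x : Fin 4 → ℝ, x ⬝ᵥ ((G.map (Int.cast : ℤ → ℝ)) *ᵥ x) =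
      ∑ i, (B *ᵥ x) i ^ 2 := by
    intro x
    rw [hB, ← Matrix.mulVec_mulVec, Matrix.dotProduct_mulVec, Matrix.vecMul_transpose]
    simp [dotProduct, sq]
  set s : Set (Fin 4 → ℝ) := (Matrix.toLin' B) ⁻¹' {y : Fin 4 → ℝ | ∑ i, y i ^ 2 < 2} with hsdef
  have hvol : (16 : ENNReal) < MeasureTheory.volume s := by
    rw [hsdef, MeasureTheory.Measure.addHaar_preimage_linearMap _ (by rwa [LinearMap.det_toLin']),
      LinearMap.det_toLin', abs_inv, hBabs]
    simpa using volume_sq_lt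
  have hconv : Convex ℝ {y : Fin 4 → ℝ | ∑ i, y i ^ 2 < 2} := by
    have h1 : ConvexOn ℝ Set.univ (fun y : Fin 4 → ℝ => ∑ i, y i ^ 2) := by
      refine ⟨convex_univ, fun x _ y _ a b ha hb hab => ?_⟩
      simp only [smul_eq_mul, Finset.mul_sum]
      rw [← Finset.sum_add_distrib]
      refine Finset.sum_le_sum fun i _ => ?_
      simp only [Pi.add_apply, Pi.smul_apply, smul_eq_mul]
      have hb' : b = 1 - a := by linarith
      subst hb'
      nlinarith [mul_nonneg (mul_nonneg ha hb) (sq_nonneg (x i - y i))]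
    simpa using h1.convex_lt 2
  have hcount : Countable (Submodule.span ℤ (Set.range (Pi.basisFun ℝ (Fin 4)))).toAddSubgroup := by
    change Countable (Submodule.span ℤ (Set.range (Pi.basisFun ℝ (Fin 4))))
    infer_instance
  obtain ⟨⟨x, hxL⟩, hx0, hxs⟩ :=
    MeasureTheory.exists_ne_zero_mem_lattice_of_measure_mul_two_pow_lt_measure
      (ZSpan.isAddFundamentalDomain' (Pi.basisFun ℝ (Fin 4)) MeasureTheory.volume) (s := s)
      (by
        intro x hx
        simp only [hsdef, Set.mem_preimage, Set.mem_ofPred_eq, map_neg, Pi.neg_apply, neg_sq]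
          at hx ⊢
        exact hx)
      (hconv.linear_preimage _)
      (by
        rw [ZSpan.volume_fundamentalDomain]
        have e : (Matrix.of (Pi.basisFun ℝ (Fin 4))) = 1 := by
          ext i j; simp [Matrix.one_apply, Pi.single_apply, eq_comm]
        rw [e]
        simp only [Matrix.det_one, abs_one, ENNReal.ofReal_one, one_mul,
          Module.finrank_fintype_fun_eq_card, Fintype.card_fin]
        norm_num
        exact hvol)
  have hmem : ∃ z : Fin 4 → ℤ, x = fun i => (z i : ℝ) := by
    have := (Module.Basis.mem_span_iff_repr_mem ℤ (Pi.basisFun ℝ (Fin 4)) x).1 hxL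
    choose z hz using this
    exact ⟨z, by funext i; simpa using (hz i).symm⟩
  obtain ⟨z, rfl⟩ := hmem
  have hz0 : z ≠ 0 := by
    rintro rfl
    apply hx0
    ext i
    simp
  have h1 : ∑ i, (B *ᵥ (fun i => (z i : ℝ))) i ^ 2 < 2 := by simpa [hsdef] using hxs
  rw [← hval] at h1
  have e2 : ((z ⬝ᵥ (G *ᵥ z) : ℤ) : ℝ) =
      (fun i => (z i : ℝ)) ⬝ᵥ ((G.map (Int.cast : ℤ → ℝ)) *ᵥ (fun i => (z i : ℝ))) := by
    simp [Matrix.mulVec, dotProduct]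
  rw [← e2] at h1
  have h2 : z ⬝ᵥ (G *ᵥ z) < 2 := by exact_mod_cast h1
  have h3 := h z hz0
  have h4 := even_value G hs he z
  omega

lemma exists_aniso (n : ℕ) : ∀ (G : Matrix (Fin 4) (Fin 4) ℤ) (D : ℤ), D.natAbs = n → G.IsSymm →
    (∀ i, 2 ∣ G i i) → (∀ x : Fin 4 → ℤ, x ≠ 0 → 0 < x ⬝ᵥ (G *ᵥ x)) → G.det = D ^ 2 →
    ∃ p : ℕ, p.Prime ∧ AnisoAt p G := by
  induction n using Nat.strong_induction_on with
  | _ n ih =>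
  intro G D hDn hs he hpos hdet
  have hd0 := det_ne_zero_of_pos G hpos
  have hD0 : D ≠ 0 := by rintro rfl; simp [hdet] at hd0
  by_cases h1 : D.natAbs = 1
  · exfalso
    refine no_even_unimodular G hs he hpos ?_
    rw [hdet, ← Int.natAbs_sq, h1]; norm_num
  obtain ⟨p, hp, hpD⟩ := Nat.exists_prime_and_dvd h1
  have hpD' : (p : ℤ) ∣ D := Int.natCast_dvd.2 hpD
  by_cases hA : ∀ x : Fin 4 → ℤ, (p : ℤ) ^ 6 ∣ x ⬝ᵥ (G *ᵥ x) → ∀ i, (p : ℤ) ∣ x i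
  · exact ⟨p, hp, aniso_of_one p hp G 6 hA⟩
  push Not at hA
  obtain ⟨x, hx, hxi⟩ := hA
  have hx2 : 2 * (p : ℤ) ^ 5 ∣ x ⬝ᵥ (G *ᵥ x) := by
    rcases hp.eq_two_or_odd' with rfl | hodd
    · norm_num at hx ⊢; exact hx
    · have hc : IsCoprime (2 : ℤ) p := by
        have := Nat.coprime_two_left.2 hodd; exact_mod_cast this.isCoprime
      exact hc.pow_right.mul_dvd (even_value G hs he x)
        (dvd_trans (pow_dvd_pow _ (by norm_num)) hx)
  obtain ⟨v, hv1, hv2, hv3⟩ := exists_v p hp G hs he D hdet hpD' x hxi hx2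
  obtain ⟨w, hw1, hw2, hw3⟩ := normalize_v p hp G hs he v hv1 hv2 hv3
  obtain ⟨G', P, D', hs', he', hP, rfl, hDD, hdet'⟩ := overlattice p hp G hs he D hdet w hw1 hw2 hw3
  have hlt : D'.natAbs < n := by
    rw [← hDn, hDD, Int.natAbs_mul, Int.natAbs_natCast]
    have : D'.natAbs ≠ 0 := by
      rw [Int.natAbs_ne_zero]; rintro rfl; simp at hDD; exact hD0 hDD
    have := hp.two_le
    nlinarith [Nat.pos_of_ne_zero ‹D'.natAbs ≠ 0›]
  obtain ⟨q, hq, hqA⟩ := ih _ hlt G' D' rfl hs' he' (pos_transfer G' P hP hpos) hdet'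
  exact ⟨q, hq, aniso_transfer q hq G' P hP hqA⟩

lemma aniso_of_square (L : Matrix (Fin 4) (Fin 4) ℤ) (hL : L.IsSymm)
    (hpos : ∀ x : Fin 4 → ℤ, x ≠ 0 → 0 < x ⬝ᵥ (L *ᵥ x)) (hsq : IsSquare L.det) :
    ∃ p : ℕ, p.Prime ∧ ∃ e : ℕ, ∀ x : Fin 4 → ℤ, (p : ℤ) ^ e ∣ x ⬝ᵥ (L *ᵥ x) →
      ∀ i, (p : ℤ) ∣ x i := by
  obtain ⟨r, hr⟩ := hsq
  obtain ⟨p, hp, hA⟩ := exists_aniso _ ((2 : ℤ) • L) (4 * r) rfl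
    (by unfold Matrix.IsSymm; rw [Matrix.transpose_smul, hL.eq]) (fun i => by simp)
    (fun x hx => by
      rw [Matrix.smul_mulVec, dotProduct_smul, smul_eq_mul]
      have := hpos x hx
      linarith)
    (by rw [Matrix.det_smul, hr]; simp; ring)
  obtain ⟨e, he⟩ := hA 1
  refine ⟨p, hp, e, fun x hx i => ?_⟩
  have := he x (by
    rw [Matrix.smul_mulVec, dotProduct_smul, smul_eq_mul]
    exact Dvd.dvd.mul_left hx _) i
  simpa using this

lemma exists_nonresidue_prime (d : ℤ) (hd : 0 < d) (hsq : ¬ IsSquare d) (N : ℕ) :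
    ∃ q : ℕ, q.Prime ∧ N < q ∧ 2 < q ∧ ∀ y : ℤ, ¬ (q : ℤ) ∣ y ^ 2 - d := by
  lift d to ℕ using hd.le
  have hd0 : 0 < d := by exact_mod_cast hd
  obtain ⟨a, b, hab, ha⟩ := Nat.sq_mul_squarefree d
  have hb0 : b ≠ 0 := by rintro rfl; simp at hab; omega
  suffices ∃ q : ℕ, q.Prime ∧ N + d + 2 < q ∧ jacobiSym a q = -1 by
    obtain ⟨q, hq, hNq, hJ⟩ := this
    have : Fact q.Prime := ⟨hq⟩
    refine ⟨q, hq, by omega, by omega, ?_⟩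
    intro y hy
    have hbd : b ≤ d := by rw [← hab]; nlinarith [Nat.pos_of_ne_zero hb0, ha.ne_zero.bot_lt]
    have hqb : ¬ q ∣ b := fun h => by
      have := Nat.le_of_dvd (Nat.pos_of_ne_zero hb0) h
      omega
    have hJd : jacobiSym (d : ℤ) q = -1 := by
      rw [← hab]
      push_cast
      rw [jacobiSym.mul_left, jacobiSym.pow_left, hJ, jacobiSym.sq_one]
      · norm_num
      · have := ((Nat.Prime.coprime_iff_not_dvd hq).2 hqb).symm
        exact_mod_cast this
    have hl : legendreSym q (d : ℤ) = -1 := by rw [jacobiSym.legendreSym.to_jacobiSym]; exact hJd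
    rw [legendreSym.eq_neg_one_iff] at hl
    apply hl
    refine ⟨(y : ZMod q), ?_⟩
    have := (ZMod.intCast_zmod_eq_zero_iff_dvd _ q).2 hy
    push_cast at this ⊢
    rw [← sq]
    exact (sub_eq_zero.1 this).symm
  by_cases hodd : ∃ r, r.Prime ∧ r ≠ 2 ∧ r ∣ a
  · obtain ⟨r, hr, hr2, m, hm⟩ := hodd
    have : Fact r.Prime := ⟨hr⟩
    have hm0 : m ≠ 0 := by rintro rfl; simp at hm; exact ha.ne_zero hm
    obtain ⟨ν, hν⟩ := FiniteField.exists_nonsquare (F := ZMod r) (by rw [ZMod.ringChar_zmod_n]; exact hr2)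
    have hrodd : Odd r := hr.odd_of_ne_two hr2
    have hrm : Nat.Coprime (4 * m) r := by
      apply Nat.Coprime.mul_left
      · have : Nat.Coprime 2 r := Nat.coprime_two_left.2 hrodd
        exact Nat.Coprime.pow_left 2 this
      · have := Nat.coprime_of_squarefree_mul (hm ▸ ha)
        exact this.symm
    obtain ⟨k, hk1, hk2⟩ := Nat.chineseRemainder hrm 1 ν.val
    have hkr : ¬ r ∣ k := by
      intro h
      have h1 : ν.val % r = 0 := by rw [← hk2]; exact Nat.mod_eq_zero_of_dvd h
      have : ν = 0 := by
        rw [← ZMod.natCast_zmod_val ν, ZMod.natCast_eq_zero_iff]; exact Nat.dvd_of_mod_eq_zero h1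
      exact hν (this ▸ IsSquare.zero)
    have hcop : Nat.Coprime k (4 * m * r) := by
      apply Nat.Coprime.mul_right
      · rw [Nat.Coprime, hk1.gcd_eq]; simp
      · exact ((Nat.Prime.coprime_iff_not_dvd hr).2 hkr).symm
    obtain ⟨q, hNq, hq, hqk⟩ := Nat.forall_exists_prime_gt_and_modEq (N + d + 2)
      (by simp [hm0, hr.ne_zero]) hcop
    refine ⟨q, hq, hNq, ?_⟩
    have hq1 : q ≡ 1 [MOD 4 * m] := (hqk.of_dvd (Dvd.intro _ rfl)).trans hk1
    have hq2 : q ≡ ν.val [MOD r] := (hqk.of_dvd (Dvd.intro_left _ rfl)).trans hk2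
    have hq4 : q % 4 = 1 := hq1.of_dvd (Dvd.intro _ rfl)
    have hqodd : Odd q := Nat.odd_iff.2 (by omega)
    rw [hm]
    push_cast
    rw [jacobiSym.mul_left, jacobiSym.mod_right' m hqodd, hq1,
      jacobiSym.quadratic_reciprocity_one_mod_four' hrodd hq4,
      ← jacobiSym.legendreSym.to_jacobiSym]
    have e1 : 1 % (4 * m) = 1 := Nat.mod_eq_of_lt (by omega)
    rw [e1, jacobiSym.one_right, mul_one, legendreSym.eq_neg_one_iff]
    have : ((q : ℤ) : ZMod r) = ν := by
      rw [Int.cast_natCast, (ZMod.natCast_eq_natCast_iff _ _ _).2 hq2, ZMod.natCast_zmod_val]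
    rw [this]; exact hν
  · push Not at hodd
    have ha2 : a = 2 := by
      have ha1 : a ≠ 1 := by
        rintro rfl
        apply hsq
        exact ⟨b, by rw [← hab]; push_cast; ring⟩
      obtain ⟨r, hr, hra⟩ := Nat.exists_prime_and_dvd ha1
      have hr2 : r = 2 := by by_contra h; exact hodd r hr h hra
      subst hr2
      obtain ⟨m, rfl⟩ := hra
      by_contra hne
      have hm1 : m ≠ 1 := by rintro rfl; simp at hne
      obtain ⟨r, hr, hrm⟩ := Nat.exists_prime_and_dvd hm1
      have hr2 : r = 2 := by by_contra h; exact hodd r hr h (Dvd.dvd.mul_left hrm 2)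
      subst hr2
      have := ha 2 (mul_dvd_mul_left 2 hrm)
      simp at this
    obtain ⟨q, hNq, hq, hqk⟩ := Nat.forall_exists_prime_gt_and_modEq (N + d + 2) (q := 8) (a := 5)
      (by norm_num) (by norm_num)
    refine ⟨q, hq, hNq, ?_⟩
    have h8 : q % 8 = 5 := hqk
    rw [ha2, jacobiSym.mod_right' 2 (Nat.odd_iff.2 (by omega))]
    norm_num [h8]

lemma det_block_mod (q : ℕ) (G : Matrix (Fin 4) (Fin 4) ℤ) (hs : G.IsSymm)
    (h00 : (q : ℤ) ∣ G 0 0) (h01 : (q : ℤ) ∣ G 0 1) (h11 : (q : ℤ) ∣ G 1 1) :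
    (q : ℤ) ∣ (G 0 2 * G 1 3 - G 0 3 * G 1 2) ^ 2 - G.det := by
  rw [← ZMod.intCast_zmod_eq_zero_iff_dvd] at *
  have h10 := hs.apply 0 1
  have h20 := hs.apply 0 2
  have h30 := hs.apply 0 3
  have h21 := hs.apply 1 2
  have h31 := hs.apply 1 3
  have h32 := hs.apply 2 3
  rw [Matrix.det_succ_row_zero]
  simp [Fin.sum_univ_succ, Matrix.det_fin_three, Fin.succAbove]
  rw [h10, h20, h30, h21, h31, h32, h00, h01, h11]
  ring

lemma minor_dvd (q : ℕ) (hq : q.Prime) (L : Matrix (Fin 4) (Fin 4) ℤ) (hs : L.IsSymm)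
    (hL : ∀ y : ℤ, ¬ (q : ℤ) ∣ y ^ 2 - L.det) (x y : Fin 4 → ℤ)
    (hxx : (q : ℤ) ∣ x ⬝ᵥ (L *ᵥ x)) (hxy : (q : ℤ) ∣ x ⬝ᵥ (L *ᵥ y))
    (hyy : (q : ℤ) ∣ y ⬝ᵥ (L *ᵥ y)) (i j : Fin 4) : (q : ℤ) ∣ x i * y j - x j * y i := by
  have hqq : Prime (q : ℤ) := Nat.prime_iff_prime_int.1 hq
  by_cases hij : i = j
  · subst hij; simp [mul_comm]
  have hσ : ∀ i j : Fin 4, i ≠ j → ∃ σ : Equiv.Perm (Fin 4), σ 0 = i ∧ σ 1 = j := by decide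
  obtain ⟨σ, rfl, rfl⟩ := hσ i j hij
  by_contra hcon
  set T : Matrix (Fin 4) (Fin 4) ℤ := !![x (σ 0), y (σ 0), 0, 0; x (σ 1), y (σ 1), 0, 0;
    x (σ 2), y (σ 2), 1, 0; x (σ 3), y (σ 3), 0, 1] with hT
  set L' := L.submatrix σ σ with hL'
  have hs' : L'.IsSymm := hs.submatrix _
  have hdetL : L'.det = L.det := Matrix.det_submatrix_equiv_self σ L
  have hc0 : (fun k => T k 0) = x ∘ σ := by funext k; fin_cases k <;> rfl
  have hc1 : (fun k => T k 1) = y ∘ σ := by funext k; fin_cases k <;> rfl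
  have hdot : ∀ u v : Fin 4 → ℤ, (u ∘ σ) ⬝ᵥ (L' *ᵥ (v ∘ σ)) = u ⬝ᵥ (L *ᵥ v) := by
    intro u v
    rw [hL', Matrix.submatrix_mulVec_equiv, Function.comp_assoc, Equiv.self_comp_symm,
      Function.comp_id, comp_equiv_dotProduct_comp_equiv]
  have hdetT : T.det = x (σ 0) * y (σ 1) - x (σ 1) * y (σ 0) := by
    rw [hT, Matrix.det_succ_row_zero]
    simp [Fin.sum_univ_succ, Matrix.det_fin_three, Fin.succAbove]
    ring
  have hmod := det_block_mod q (Tᵀ * L' * T) (symm_conj L' T hs')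
    (by rw [conj_apply', hc0, hdot]; exact hxx)
    (by rw [conj_apply', hc0, hc1, hdot]; exact hxy)
    (by rw [conj_apply', hc1, hdot]; exact hyy)
  rw [Matrix.det_mul, Matrix.det_mul, Matrix.det_transpose, hdetL, hdetT] at hmod
  set m := x (σ 0) * y (σ 1) - x (σ 1) * y (σ 0) with hm
  obtain ⟨u, v, huv⟩ : IsCoprime m (q : ℤ) := ((Prime.coprime_iff_not_dvd hqq).2 hcon).symm
  generalize (Tᵀ * L' * T) 0 2 * (Tᵀ * L' * T) 1 3 - (Tᵀ * L' * T) 0 3 * (Tᵀ * L' * T) 1 2 = w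
    at hmod
  apply hL (u * w)
  obtain ⟨c, hc⟩ := hmod
  refine ⟨u ^ 2 * c + L.det * (q * v ^ 2 - 2 * v), ?_⟩
  have e : u * m = 1 - v * q := by linarith
  have : (u * w) ^ 2 = u ^ 2 * (q * c) + (u * m) ^ 2 * L.det := by rw [← hc]; ring
  rw [this, e]; ring

lemma nonresidue_aniso (q : ℕ) (hq : q.Prime) (d : ℤ) (hd : ∀ y : ℤ, ¬ (q : ℤ) ∣ y ^ 2 - d)
    (X Y : ℤ) (h : (q : ℤ) ∣ X ^ 2 - d * Y ^ 2) : (q : ℤ) ∣ X ∧ (q : ℤ) ∣ Y := by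
  have hqq : Prime (q : ℤ) := Nat.prime_iff_prime_int.1 hq
  have hY : (q : ℤ) ∣ Y := by
    by_contra hY
    obtain ⟨u, v, huv⟩ : IsCoprime Y (q : ℤ) := ((Prime.coprime_iff_not_dvd hqq).2 hY).symm
    apply hd (u * X)
    obtain ⟨c, hc⟩ := h
    refine ⟨u ^ 2 * c + d * (q * v ^ 2 - 2 * v), ?_⟩
    have e : u * Y = 1 - v * q := by linarith
    have : (u * X) ^ 2 = u ^ 2 * (q * c) + (u * Y) ^ 2 * d := by rw [← hc]; ring
    rw [this, e]; ring
  refine ⟨hqq.dvd_of_dvd_pow (n := 2) ?_, hY⟩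
  obtain ⟨c, rfl⟩ := hY
  have := dvd_add h (show (q : ℤ) ∣ d * (q * c) ^ 2 from ⟨d * q * c ^ 2, by ring⟩)
  simpa using this

lemma not_rep_nonsquare (q : ℕ) (hq : q.Prime) (L : Matrix (Fin 4) (Fin 4) ℤ) (hs : L.IsSymm)
    (hL : ∀ y : ℤ, ¬ (q : ℤ) ∣ y ^ 2 - L.det) (ν : ℤ) (hν : ∀ y : ℤ, ¬ (q : ℤ) ∣ y ^ 2 - ν)
    (N : Matrix (Fin 2) (Fin 2) ℤ) (h00 : (q : ℤ) ^ 2 ∣ N 0 0 - q) (h01 : (q : ℤ) ^ 2 ∣ N 0 1)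
    (h11 : (q : ℤ) ^ 2 ∣ N 1 1 - (- q * ν)) (T : Matrix (Fin 4) (Fin 2) ℤ)
    (hT : Tᵀ * L * T = N) : False := by
  have hqq : Prime (q : ℤ) := Nat.prime_iff_prime_int.1 hq
  have hNs : N.IsSymm := hT ▸ symm_conj L T hs
  have h10 := hNs.apply 0 1
  obtain ⟨a, ha⟩ := h00
  obtain ⟨b, hb⟩ := h01
  obtain ⟨c, hc⟩ := h11
  have hmin := minor_dvd q hq L hs hL (fun k => T k 0) (fun k => T k 1)
    (by rw [← conj_apply', hT]; exact ⟨1 + q * a, by linear_combination ha⟩)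
    (by rw [← conj_apply', hT]; exact ⟨q * b, by linear_combination hb⟩)
    (by rw [← conj_apply', hT]; exact ⟨- ν + q * c, by linear_combination hc⟩)
  have key : ∀ X Y : ℤ, (∀ i, (q : ℤ) ∣ X * T i 0 + Y * T i 1) → (q : ℤ) ∣ X ∧ (q : ℤ) ∣ Y := by
    intro X Y h
    apply nonresidue_aniso q hq ν hν
    choose z hz using h
    have h1 := conj_value L T ![X, Y]
    have h2 : T *ᵥ ![X, Y] = (q : ℤ) • z := by
      funext i
      simp only [Matrix.mulVec, dotProduct, Fin.sum_univ_two, Pi.smul_apply, smul_eq_mul]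
      rw [← hz i]
      simp
      ring
    rw [hT, h2, Matrix.mulVec_smul, dotProduct_smul, smul_dotProduct] at h1
    simp only [Matrix.mulVec, dotProduct, Fin.sum_univ_two, smul_eq_mul] at h1
    simp at h1
    rw [h10] at h1
    generalize (∑ x, z x * ∑ x_1, L x x_1 * z x_1) = w at h1
    have h3 : (q : ℤ) * (X ^ 2 - ν * Y ^ 2) =
        q * (q * (w - a * X ^ 2 - 2 * b * X * Y - c * Y ^ 2)) := by
      linear_combination h1 - X ^ 2 * ha - 2 * X * Y * hb - Y ^ 2 * hc
    exact ⟨_, mul_left_cancel₀ hqq.ne_zero h3⟩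
  by_cases hx : ∀ i, (q : ℤ) ∣ T i 0
  · have := (key 1 0 (by simpa using hx)).1
    exact hqq.not_isUnit (isUnit_of_dvd_one this)
  · push Not at hx
    obtain ⟨i, hi⟩ := hx
    have := (key (T i 1) (- T i 0) (fun j => by
      have := hmin j i
      convert this using 1; ring)).2
    exact hi (by simpa using this)

lemma not_rep_square (p : ℕ) (hp : p.Prime) (L : Matrix (Fin 4) (Fin 4) ℤ) (e E : ℕ) (heE : e ≤ E)
    (hE : E ≠ 0)
    (hA : ∀ x : Fin 4 → ℤ, (p : ℤ) ^ e ∣ x ⬝ᵥ (L *ᵥ x) → ∀ i, (p : ℤ) ∣ x i)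
    (N : Matrix (Fin 2) (Fin 2) ℤ) (h00 : (p : ℤ) ^ E ∣ N 0 0) (h10 : (p : ℤ) ^ E ∣ N 1 0 - 1)
    (T : Matrix (Fin 4) (Fin 2) ℤ) (hT : Tᵀ * L * T = N) : False := by
  have hpp : Prime (p : ℤ) := Nat.prime_iff_prime_int.1 hp
  have h1 := hA (fun k => T k 0) (by
    rw [← conj_apply', hT]; exact dvd_trans (pow_dvd_pow _ heE) h00)
  have h2 : (p : ℤ) ∣ N 1 0 := by
    rw [← hT, conj_apply']
    apply dvd_dot
    intro i
    exact dvd_dot _ _ _ h1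
  have h3 : (p : ℤ) ∣ N 1 0 - 1 := dvd_trans (dvd_pow_self _ hE) h10
  have := dvd_sub h2 h3
  rw [sub_sub_cancel] at this
  exact hpp.not_isUnit (isUnit_of_dvd_one this)

lemma crt_int (s : Finset ℕ) (m : ℕ → ℕ) (hm : ∀ i ∈ s, m i ≠ 0)
    (hc : Set.Pairwise (s : Set ℕ) (Function.onFun Nat.Coprime m)) (a : ℕ → ℤ) :
    ∃ k : ℤ, ∀ i ∈ s, (m i : ℤ) ∣ k - a i := by
  obtain ⟨k, hk⟩ := Nat.chineseRemainderOfFinset (fun i => (a i % m i).toNat) m s hm hc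
  refine ⟨k, fun i hi => ?_⟩
  have h0 : (m i : ℤ) ≠ 0 := by exact_mod_cast hm i hi
  have h1 := (Int.natCast_modEq_iff.2 (hk i hi))
  rw [Int.toNat_of_nonneg (Int.emod_nonneg _ h0)] at h1
  exact ((h1.trans (Int.mod_modEq _ _)).symm).dvd

lemma isPDForm_binary (A B C : ℤ) (hA : 0 < A) (hD : 0 < A * C - B ^ 2) :
    IsPDForm !![A, B; B, C] := by
  refine ⟨?_, ?_⟩
  · ext i j; fin_cases i <;> fin_cases j <;> rfl
  · intro x hx
    have e : x ⬝ᵥ (!![A, B; B, C] *ᵥ x) = A * x 0 ^ 2 + 2 * B * x 0 * x 1 + C * x 1 ^ 2 := by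
      simp [Matrix.mulVec, dotProduct, Fin.sum_univ_two]; ring
    rw [e]
    have h1 : 0 < A * (A * x 0 ^ 2 + 2 * B * x 0 * x 1 + C * x 1 ^ 2) := by
      have e2 : A * (A * x 0 ^ 2 + 2 * B * x 0 * x 1 + C * x 1 ^ 2) =
        (A * x 0 + B * x 1) ^ 2 + (A * C - B ^ 2) * x 1 ^ 2 := by ring
      rw [e2]
      by_cases hy : x 1 = 0
      · have hx0 : x 0 ≠ 0 := by
          intro h0; apply hx; funext i; fin_cases i <;> simp [h0, hy]
        rw [hy]
        have : 0 < (A * x 0) ^ 2 := by positivity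
        simpa using this
      · have : 0 < (A * C - B ^ 2) * x 1 ^ 2 := by positivity
        nlinarith [sq_nonneg (A * x 0 + B * x 1)]
    exact (mul_pos_iff_of_pos_left hA).1 h1

lemma isom_det {A B : Matrix (Fin 2) (Fin 2) ℤ} (h : IsomForm A B) : A.det = B.det := by
  obtain ⟨U, hU, rfl⟩ := h
  rw [Matrix.det_mul, Matrix.det_mul, Matrix.det_transpose]
  rcases Int.isUnit_iff.1 hU with h | h <;> simp [h]

lemma det_pos_of_pd (L : Matrix (Fin 4) (Fin 4) ℤ) (hL : IsPDForm L) : 0 < L.det := by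
  have h0 := det_ne_zero_of_pos L hL.2
  have hpsd : (L.map (Int.cast : ℤ → ℝ)).PosSemidef := by
    refine .of_dotProduct_mulVec_nonneg ?_ fun x => by simpa using real_nonneg L hL.2 x
    ext i j
    simp [hL.1.apply]
  have h1 := hpsd.det_nonneg
  have h2 := (Int.castRingHom ℝ).map_det L
  have h3 : ((L.det : ℤ) : ℝ) = (L.map (Int.cast : ℤ → ℝ)).det := by simpa using h2
  rw [← h3] at h1
  have h4 : 0 ≤ L.det := by exact_mod_cast h1
  omega

/-- For any finite list of positive definite integral quaternary forms, there are infinitely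
many pairwise non-isometric positive definite integral binary forms represented by none
of them. -/
theorem infinitely_many_binary_not_represented (t : ℕ)
    (L : Fin t → Matrix (Fin 4) (Fin 4) ℤ) (hL : ∀ i, IsPDForm (L i)) :
    ∃ f : ℕ → Matrix (Fin 2) (Fin 2) ℤ,
      (∀ i, IsPDForm (f i)) ∧
      (∀ i j, i ≠ j → ¬ IsomForm (f i) (f j)) ∧
      (∀ i k, ¬ Represents (L k) (f i)) := by
  classical
  have h1 : ∀ i, ∃ p e : ℕ, IsSquare (L i).det → p.Prime ∧ ∀ x : Fin 4 → ℤ,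
      (p : ℤ) ^ e ∣ x ⬝ᵥ (L i *ᵥ x) → ∀ j, (p : ℤ) ∣ x j := by
    intro i
    by_cases hsq : IsSquare (L i).det
    · obtain ⟨p, hp, e, he⟩ := aniso_of_square (L i) (hL i).1 (hL i).2 hsq
      exact ⟨p, e, fun _ => ⟨hp, he⟩⟩
    · exact ⟨0, 0, fun h => absurd h hsq⟩
  choose p e hpe using h1
  have h2 : ∀ i, ∃ q : ℕ, ¬ IsSquare (L i).det → q.Prime ∧ (∑ i, p i) < q ∧
      ∀ y : ℤ, ¬ (q : ℤ) ∣ y ^ 2 - (L i).det := by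
    intro i
    by_cases hsq : IsSquare (L i).det
    · exact ⟨0, fun h => absurd hsq h⟩
    · obtain ⟨q, hq, hN, -, h⟩ := exists_nonresidue_prime _ (det_pos_of_pd _ (hL i)) hsq (∑ i, p i)
      exact ⟨q, fun _ => ⟨hq, hN, h⟩⟩
  choose q hq using h2
  set S : Finset ℕ := (Finset.univ.filter fun i => IsSquare (L i).det).image p with hS
  set R : Finset ℕ := (Finset.univ.filter fun i => ¬ IsSquare (L i).det).image q with hR
  have hSp : ∀ r ∈ S, r.Prime ∧ r ≤ ∑ i, p i := by
    intro r hr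
    simp only [hS, Finset.mem_image, Finset.mem_filter, Finset.mem_univ, true_and] at hr
    obtain ⟨i, hi, rfl⟩ := hr
    exact ⟨(hpe i hi).1, Finset.single_le_sum (fun _ _ => Nat.zero_le _) (Finset.mem_univ i)⟩
  have hRp : ∀ r ∈ R, r.Prime ∧ (∑ i, p i) < r ∧ ∃ ν : ℤ, ∀ y : ℤ, ¬ (r : ℤ) ∣ y ^ 2 - ν := by
    intro r hr
    simp only [hR, Finset.mem_image, Finset.mem_filter, Finset.mem_univ, true_and] at hr
    obtain ⟨i, hi, rfl⟩ := hr
    exact ⟨(hq i hi).1, (hq i hi).2.1, _, (hq i hi).2.2⟩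
  have hν : ∀ r, ∃ ν : ℤ, r ∈ R → ∀ y : ℤ, ¬ (r : ℤ) ∣ y ^ 2 - ν := by
    intro r
    by_cases hr : r ∈ R
    · obtain ⟨ν, h⟩ := (hRp r hr).2.2
      exact ⟨ν, fun _ => h⟩
    · exact ⟨0, fun h => absurd h hr⟩
  choose ν hν using hν
  have hdisj : ∀ r ∈ R, r ∉ S := fun r hr hr' => by
    have := (hSp r hr').2
    have := (hRp r hr).2.1
    omega
  set E := (∑ i, e i) + 1 with hE
  have heE : ∀ i, e i ≤ E := fun i =>
    (Finset.single_le_sum (fun _ _ => Nat.zero_le _) (Finset.mem_univ i)).trans (Nat.le_succ _)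
  set m : ℕ → ℕ := fun r => if r ∈ S then r ^ E else r ^ 2 with hm
  have hprime : ∀ r ∈ S ∪ R, r.Prime := by
    intro r hr
    rcases Finset.mem_union.1 hr with h | h
    · exact (hSp r h).1
    · exact (hRp r h).1
  have hm0 : ∀ r ∈ S ∪ R, m r ≠ 0 := by
    intro r hr
    have := (hprime r hr).ne_zero
    simp only [hm]; split_ifs <;> exact pow_ne_zero _ this
  have hcop : Set.Pairwise ((S ∪ R : Finset ℕ) : Set ℕ) (Function.onFun Nat.Coprime m) := by
    intro r hr s hs hrs
    have h := (Nat.coprime_primes (hprime r (by exact_mod_cast hr))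
      (hprime s (by exact_mod_cast hs))).2 hrs
    simp only [Function.onFun, hm]
    split_ifs <;> exact Nat.Coprime.pow _ _ h
  obtain ⟨A₀, hA₀⟩ := crt_int _ m hm0 hcop (fun r => if r ∈ S then 0 else (r : ℤ))
  obtain ⟨B, hB⟩ := crt_int _ m hm0 hcop (fun r => if r ∈ S then 1 else 0)
  obtain ⟨C₀, hC₀⟩ := crt_int _ m hm0 hcop (fun r => if r ∈ S then 0 else (- (r : ℤ) * ν r))
  set M : ℤ := ((∏ r ∈ S ∪ R, m r : ℕ) : ℤ) with hM
  have hM1 : 1 ≤ M := by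
    rw [hM]; exact_mod_cast Nat.pos_of_ne_zero (Finset.prod_ne_zero_iff.2 hm0)
  have hMd : ∀ r ∈ S ∪ R, (m r : ℤ) ∣ M := fun r hr => by
    rw [hM]; exact_mod_cast Finset.dvd_prod_of_mem m hr
  set A : ℤ := A₀ + M * (|A₀| + 1) with hA
  set C : ℕ → ℤ := fun k => C₀ + M * (|C₀| + B ^ 2 + 1 + k) with hC
  have hA1 : 1 ≤ A := by
    have := neg_abs_le A₀
    have h3 := abs_nonneg A₀
    rw [hA]; nlinarith
  have hC1 : ∀ k, B ^ 2 + 1 ≤ C k := fun k => by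
    have := neg_abs_le C₀
    have h3 := abs_nonneg C₀
    have h4 : (0 : ℤ) ≤ k := Int.natCast_nonneg k
    have h5 := sq_nonneg B
    simp only [hC]; nlinarith
  have hAr : ∀ r ∈ S ∪ R, (m r : ℤ) ∣ A - (if r ∈ S then 0 else (r : ℤ)) := fun r hr => by
    have := dvd_add (hA₀ r hr) (Dvd.dvd.mul_right (hMd r hr) (|A₀| + 1))
    have e1 : A - (if r ∈ S then 0 else (r : ℤ)) =
        (A₀ - if r ∈ S then 0 else (r : ℤ)) + M * (|A₀| + 1) := by rw [hA]; ring
    rw [e1]; exact this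
  have hCr : ∀ k, ∀ r ∈ S ∪ R, (m r : ℤ) ∣ C k - (if r ∈ S then 0 else (- (r : ℤ) * ν r)) :=
    fun k r hr => by
      have := dvd_add (hC₀ r hr) (Dvd.dvd.mul_right (hMd r hr) (|C₀| + B ^ 2 + 1 + k))
      have e1 : C k - (if r ∈ S then 0 else (- (r : ℤ) * ν r)) =
          (C₀ - if r ∈ S then 0 else (- (r : ℤ) * ν r)) + M * (|C₀| + B ^ 2 + 1 + k) := by
        simp only [hC]; ring
      rw [e1]; exact this
  refine ⟨fun k => !![A, B; B, C k], ?_, ?_, ?_⟩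
  · intro k
    apply isPDForm_binary _ _ _ (by linarith)
    have := hC1 k
    nlinarith [sq_nonneg B]
  · intro i j hij hiso
    have := isom_det hiso
    simp only [Matrix.det_fin_two_of] at this
    have h3 : A * C i = A * C j := by linarith
    have h4 := mul_left_cancel₀ (by linarith : A ≠ 0) h3
    simp only [hC] at h4
    have h5 := mul_left_cancel₀ (by linarith : M ≠ 0) (add_left_cancel h4)
    apply hij
    have h6 : (i : ℤ) = j := by linarith
    exact_mod_cast h6
  · rintro k i ⟨T, hT⟩
    by_cases hsq : IsSquare (L i).det
    · have hr : p i ∈ S := by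
        rw [hS]; exact Finset.mem_image_of_mem _ (by simpa using hsq)
      have hr' : p i ∈ S ∪ R := Finset.mem_union_left _ hr
      have hmr : ((m (p i) : ℕ) : ℤ) = (p i : ℤ) ^ E := by simp [hm, hr]
      have a1 := hAr _ hr'
      have a2 := hB _ hr'
      rw [hmr, if_pos hr] at a1 a2
      exact not_rep_square (p i) (hpe i hsq).1 (L i) (e i) E (heE i) (by omega) (hpe i hsq).2 _
        (by simpa using a1) (by simpa using a2) T hT
    · have hr : q i ∈ R := by
        rw [hR]; exact Finset.mem_image_of_mem _ (by simpa using hsq)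
      have hr' : q i ∈ S ∪ R := Finset.mem_union_right _ hr
      have hrS := hdisj _ hr
      have hmr : ((m (q i) : ℕ) : ℤ) = (q i : ℤ) ^ 2 := by simp [hm, hrS]
      have a1 := hAr _ hr'
      have a2 := hB _ hr'
      have a3 := hCr k _ hr'
      rw [hmr, if_neg hrS] at a1 a2 a3
      exact not_rep_nonsquare (q i) (hq i hsq).1 (L i) (hL i).1 (hq i hsq).2.2 (ν (q i))
        (hν _ hr) _ (by simpa using a1) (by simpa using a2) (by simpa using a3) T hT
end

section
/- For every positive definite integral binary quadratic form ℓ, there exist a positive definite integral binary quadratic form ℓ₁ and infinitely many pairwise non-isometric positive definite integral binary quadratic forms ℓ₂ such that no positive definite integral quaternary quadratic form represents all three forms ℓ, ℓ₁, and ℓ₂. In particular, since any two binary forms ℓ₁ and ℓ₂ are represented by the quaternary form ℓ₁ ⊥ ℓ₂, this gives κ(2,4) = 2. -/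
open Matrix

lemma kt_jac_one (δ b : ℕ) (hδ : 0 < δ) (h : 4 * δ ∣ b + 1) : jacobiSym δ b = 1 := by
  obtain ⟨c, hc⟩ := h
  have hb : Odd b := by
    have : 4 * δ * c = 2 * (2 * δ * c) := by ring
    rw [Nat.odd_iff]; omega
  have hcpos : 0 < c := by
    rcases Nat.eq_zero_or_pos c with h | h
    · simp [h] at hc
    · exact h
  have hmod : b % (4 * δ) = 4 * δ - 1 := by
    obtain ⟨c', rfl⟩ : ∃ c', c = c' + 1 := ⟨c - 1, by omega⟩
    have : b = (4 * δ - 1) + 4 * δ * c' := by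
      have : 4 * δ * (c' + 1) = 4 * δ * c' + 4 * δ := by ring
      omega
    rw [this, Nat.add_mul_mod_self_left]
    exact Nat.mod_eq_of_lt (by omega)
  rw [jacobiSym.mod_right' δ hb, hmod]
  have hodd : Odd (4 * δ - 1) := by rw [Nat.odd_iff]; omega
  have h4 := jacobiSym.at_four hodd
  have h1 : jacobiSym (4 * δ) (4 * δ - 1) = 1 := by
    rw [← jacobiSym.one_left (4 * δ - 1)]
    apply jacobiSym.mod_left'
    have : (4 * (δ : ℤ)) = 1 + ((4 * δ - 1 : ℕ) : ℤ) := by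
      push_cast [Nat.cast_sub (show 1 ≤ 4 * δ by omega)]; ring
    rw [this, Int.add_emod_right]
  rw [jacobiSym.mul_left, h4, one_mul] at h1
  exact h1

lemma kt_jac_neg_one (δ b : ℕ) (hδ : 0 < δ) (h : 4 * δ ∣ b + 1) : jacobiSym (-δ) b = -1 := by
  have h3 : b % 4 = 3 := by
    have : 4 ∣ b + 1 := (Dvd.intro _ rfl).trans h
    omega
  have hb : Odd b := by rw [Nat.odd_iff]; omega
  rw [jacobiSym.neg _ hb, kt_jac_one δ b hδ h, ZMod.χ₄_nat_three_mod_four h3]; rfl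

/-- For `p ≡ 3 mod 4` and `r` odd, `(r / p) = (-p / r)`. -/
lemma kt_recip (r p : ℕ) (hr : Odd r) (hp : p % 4 = 3) :
    jacobiSym (-p) r = jacobiSym r p := by
  have hpo : Odd p := by rw [Nat.odd_iff]; omega
  rw [jacobiSym.neg _ hr]
  rcases Nat.odd_mod_four_iff.mp (Nat.odd_iff.mp hr) with h | h
  · rw [ZMod.χ₄_nat_one_mod_four h, one_mul, jacobiSym.quadratic_reciprocity_one_mod_four h hpo]
  · rw [ZMod.χ₄_nat_three_mod_four h, jacobiSym.quadratic_reciprocity_three_mod_four h hp]; ring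

lemma kt_exists_nonres (r : ℕ) (hr : r.Prime) (h2 : r ≠ 2) :
    ∃ u : ℕ, jacobiSym (-u) r = -1 := by
  have := Fact.mk hr
  obtain ⟨a, ha⟩ := FiniteField.exists_nonsquare (F := ZMod r) (by rwa [ZMod.ringChar_zmod_n])
  refine ⟨(-a).val, ?_⟩
  rw [← jacobiSym.legendreSym.to_jacobiSym, legendreSym.eq_neg_one_iff]
  simpa using ha

lemma kt_inert_prime (d : ℕ) (hd : 0 < d) (hns : ¬ IsSquare d) (N : ℕ) :
    ∃ p > N, p.Prime ∧ p % 4 = 3 ∧ jacobiSym d p = -1 := by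
  obtain ⟨a, b, ha, hb, hab, hsq⟩ := Nat.sq_mul_squarefree_of_pos hd
  have ha1 : a ≠ 1 := by
    rintro rfl
    exact hns ⟨b, by rw [← hab]; ring⟩
  -- reduce to the squarefree part
  suffices H : ∃ p > max N d, p.Prime ∧ p % 4 = 3 ∧ jacobiSym a p = -1 by
    obtain ⟨p, hp, hpp, h3, hJ⟩ := H
    refine ⟨p, lt_of_le_of_lt (le_max_left _ _) hp, hpp, h3, ?_⟩
    have hbp : (b : ℤ).gcd p = 1 := by
      rw [Int.gcd_natCast_natCast]
      apply Nat.Coprime.symm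
      rw [hpp.coprime_iff_not_dvd]
      intro h
      have h1 := Nat.le_of_dvd hb h
      have h2 : d < p := lt_of_le_of_lt (le_max_right _ _) hp
      nlinarith
    rw [← hab]
    push_cast
    rw [jacobiSym.mul_left, jacobiSym.sq_one' hbp, hJ, one_mul]
  by_cases hodd : ∃ r, r.Prime ∧ r ≠ 2 ∧ r ∣ a
  · obtain ⟨r, hr, hr2, k, rfl⟩ := hodd
    have hk : 0 < k := Nat.pos_of_mul_pos_left ha
    have hcop : Nat.Coprime r (4 * k) := by
      rw [hr.coprime_iff_not_dvd]
      intro h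
      rcases (hr.dvd_mul).1 h with h | h
      · have : r ∣ 2 ^ 2 := h
        have := hr.dvd_of_dvd_pow this
        exact hr2 ((Nat.prime_dvd_prime_iff_eq hr Nat.prime_two).1 this)
      · exact hr.one_lt.ne' (Nat.isUnit_iff.1 (hsq r (Nat.mul_dvd_mul_left r h)))
    obtain ⟨u, hu⟩ := kt_exists_nonres r hr hr2
    obtain ⟨c, hc1, hc2⟩ := Nat.chineseRemainder hcop u (4 * k - 1)
    have hur : Nat.Coprime u r := by
      by_contra hn
      have : jacobiSym (-u) r = 0 := by
        rw [jacobiSym.eq_zero_iff]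
        refine ⟨hr.ne_zero, ?_⟩
        rwa [Int.neg_gcd, Int.gcd_natCast_natCast]
      rw [this] at hu; norm_num at hu
    have hcc : Nat.Coprime c (r * (4 * k)) := by
      apply Nat.Coprime.mul_right
      · rw [Nat.Coprime, hc1.gcd_eq]; exact hur
      · rw [Nat.Coprime, hc2.gcd_eq]
        have := Nat.coprime_self_sub_right (show 1 ≤ 4 * k by omega)
        rw [Nat.gcd_comm]
        exact this.2 (by simp)
    obtain ⟨p, hp, hpp, hpm⟩ := Nat.forall_exists_prime_gt_and_modEq (max N d)
      (q := r * (4 * k)) (a := c) (by have := hr.pos; positivity) hcc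
    have hpr : p ≡ u [MOD r] := (hpm.of_mul_right _).trans hc1
    have hpk : p ≡ 4 * k - 1 [MOD 4 * k] := (hpm.of_mul_left _).trans hc2
    have hdvd : 4 * k ∣ p + 1 := by
      have := hpk.add_right 1
      rw [Nat.sub_add_cancel (by omega)] at this
      exact (Nat.modEq_zero_iff_dvd).1 (this.trans (by simp [Nat.ModEq]))
    have h3 : p % 4 = 3 := by
      have : 4 ∣ p + 1 := (Dvd.intro _ rfl).trans hdvd
      omega
    refine ⟨p, hp, hpp, h3, ?_⟩
    push_cast
    rw [jacobiSym.mul_left, kt_jac_one k p hk hdvd, mul_one,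
      ← kt_recip r p (hr.odd_of_ne_two hr2) h3, ← hu]
    apply jacobiSym.mod_left'
    have : (p : ℤ) ≡ u [ZMOD r] := (Int.natCast_modEq_iff).2 hpr
    exact this.neg
  · push Not at hodd
    have ha2 : a = 2 := by
      obtain ⟨r, hr, hra⟩ := Nat.exists_prime_and_dvd ha1
      have hr2 : r = 2 := by
        by_contra h
        exact hodd r hr h hra
      subst hr2
      obtain ⟨k, rfl⟩ := hra
      by_contra hk
      obtain ⟨s, hs, hsk⟩ := Nat.exists_prime_and_dvd (n := k) (by omega)
      have hs2 : s = 2 := by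
        by_contra h
        exact hodd s hs h (hsk.mul_left 2)
      subst hs2
      have := hsq 2 (Nat.mul_dvd_mul_left 2 hsk)
      rw [Nat.isUnit_iff] at this; omega
    subst ha2
    obtain ⟨p, hp, hpp, hpm⟩ := Nat.forall_exists_prime_gt_and_modEq (max N d)
      (q := 8) (a := 3) (by norm_num) (by norm_num)
    have h8 : p % 8 = 3 := hpm
    refine ⟨p, hp, hpp, by omega, ?_⟩
    have hpo : Odd p := by rw [Nat.odd_iff]; omega
    have := jacobiSym.at_two hpo
    push_cast
    rw [this, ZMod.χ₈_nat_eq_if_mod_eight]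
    simp [h8]; omega

lemma kt_jac_prod (q n : ℕ) (hn : n ≠ 0) (h : ∀ p, p.Prime → p ∣ n → jacobiSym p q = 1) :
    jacobiSym n q = 1 := by
  induction n using Nat.recOnMul with
  | zero => exact absurd rfl hn
  | one => simp
  | prime p hp => exact h p hp dvd_rfl
  | mul a b iha ihb =>
    push_cast
    rw [jacobiSym.mul_left, iha (by rintro rfl; simp at hn) fun p hp hd => h p hp (hd.mul_right _),
      ihb (by rintro rfl; simp at hn) fun p hp hd => h p hp (hd.mul_left _), one_mul]

/-- The bilinear form attached to a matrix. -/
def ktB {m : ℕ} (L : Matrix (Fin m) (Fin m) ℤ) (x y : Fin m → ℤ) : ℤ := x ⬝ᵥ L.mulVec y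

section bil
variable {m : ℕ} (L : Matrix (Fin m) (Fin m) ℤ)

lemma ktB_add_left (x y z : Fin m → ℤ) : ktB L (x + y) z = ktB L x z + ktB L y z := by
  simp [ktB, add_dotProduct]
lemma ktB_add_right (x y z : Fin m → ℤ) : ktB L x (y + z) = ktB L x y + ktB L x z := by
  simp [ktB, mulVec_add, dotProduct_add]
lemma ktB_smul_left (a : ℤ) (x z : Fin m → ℤ) : ktB L (a • x) z = a * ktB L x z := by
  rw [ktB, smul_dotProduct, smul_eq_mul, ktB]
lemma ktB_smul_right (a : ℤ) (x z : Fin m → ℤ) : ktB L x (a • z) = a * ktB L x z := by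
  rw [ktB, mulVec_smul, dotProduct_smul, smul_eq_mul, ktB]
lemma ktB_symm (hL : L.IsSymm) (x y : Fin m → ℤ) : ktB L x y = ktB L y x := by
  unfold ktB
  rw [dotProduct_mulVec, dotProduct_comm, ← mulVec_transpose, hL.eq]

lemma ktB_nonneg (hL : IsPDForm L) (x : Fin m → ℤ) : 0 ≤ ktB L x x := by
  by_cases h : x = 0
  · simp [ktB, h]
  · exact (hL.2 x h).le

lemma kt_gram_det (R : Matrix (Fin m) (Fin m) ℤ) :
    (Matrix.of fun i j => ktB L (R i) (R j)).det = L.det * R.det ^ 2 := by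
  have : (Matrix.of fun i j => ktB L (R i) (R j)) = R * L * Rᵀ := by
    ext i j
    simp only [ktB, of_apply, dotProduct_mulVec]
    rfl
  rw [this, det_mul, det_mul, det_transpose]; ring

end bil

/-- `Q(s x + t y) = P (s² + q t²)` divisible by `p²` forces `p ∣ s, t`. -/
lemma kt_indep (L : Matrix (Fin 4) (Fin 4) ℤ) (hL : L.IsSymm) (p q P : ℕ) (hp : p.Prime)
    (hP : Squarefree P) (hq : jacobiSym (-q) p = -1) (x y : Fin 4 → ℤ)
    (hxx : ktB L x x = P) (hxy : ktB L x y = 0) (hyy : ktB L y y = P * q)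
    (s t : ℤ) (z : Fin 4 → ℤ) (h : s • x + t • y = (p : ℤ) • z) : (p : ℤ) ∣ s ∧ (p : ℤ) ∣ t := by
  have := Fact.mk hp
  have hyx : ktB L y x = 0 := by rw [ktB_symm L hL]; exact hxy
  have h1 : ktB L (s • x + t • y) (s • x + t • y) = P * (s ^ 2 + q * t ^ 2) := by
    simp only [ktB_add_left, ktB_add_right, ktB_smul_left, ktB_smul_right, hxx, hxy, hyy, hyx]
    ring
  rw [h] at h1
  simp only [ktB_smul_left, ktB_smul_right] at h1
  apply jacobiSym.prime_dvd_of_eq_neg_one hq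
  have e : s ^ 2 - -(q : ℤ) * t ^ 2 = s ^ 2 + q * t ^ 2 := by ring
  rw [e]
  by_contra hn
  have hpZ : Prime (p : ℤ) := Nat.prime_iff_prime_int.mp hp
  have hcop : IsCoprime ((p : ℤ) ^ 2) (s ^ 2 + q * t ^ 2) :=
    IsCoprime.pow_left ((hpZ.coprime_iff_not_dvd).2 hn)
  have h2 : (p : ℤ) ^ 2 ∣ P := hcop.dvd_of_dvd_mul_right ⟨ktB L z z, by rw [← h1]; ring⟩
  have h3 : p * p ∣ P := by rw [← sq]; exact_mod_cast h2
  exact hp.one_lt.ne' (Nat.isUnit_iff.1 (hP p h3))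

/-- reduction of an integer vector mod `p`. -/
def ktR (p : ℕ) (x : Fin 4 → ℤ) : Fin 4 → ZMod p := fun i => (x i : ZMod p)

lemma ktR_surj (p : ℕ) (x : Fin 4 → ZMod p) : ∃ y, ktR p y = x := by
  choose y hy using fun i => ZMod.intCast_surjective (x i)
  exact ⟨y, funext hy⟩

lemma ktR_eq (p : ℕ) (x y : Fin 4 → ℤ) (h : ktR p x = ktR p y) :
    ∃ z, x = y + (p : ℤ) • z := by
  have : ∀ i, ∃ c, x i - y i = p * c := fun i => by
    have := congrFun h i
    simp only [ktR] at this
    have h2 : ((x i - y i : ℤ) : ZMod p) = 0 := by push_cast; rw [this, sub_self]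
    exact (ZMod.intCast_zmod_eq_zero_iff_dvd _ _).1 h2
  choose z hz using this
  exact ⟨z, funext fun i => by simp [← hz]⟩

lemma ktR_lin (p : ℕ) (s t : ℤ) (x y : Fin 4 → ℤ) :
    (s : ZMod p) • ktR p x + (t : ZMod p) • ktR p y = ktR p (s • x + t • y) := by
  ext i; simp [ktR]

lemma kt_LI2 (p : ℕ) [Fact p.Prime] (x y : Fin 4 → ℤ)
    (h : ∀ (s t : ℤ) (z : Fin 4 → ℤ), s • x + t • y = (p : ℤ) • z → (p : ℤ) ∣ s ∧ (p : ℤ) ∣ t) :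
    LinearIndependent (ZMod p) ![ktR p x, ktR p y] := by
  rw [LinearIndependent.pair_iff]
  intro s t hst
  obtain ⟨s, rfl⟩ := ZMod.intCast_surjective s
  obtain ⟨t, rfl⟩ := ZMod.intCast_surjective t
  rw [ktR_lin] at hst
  obtain ⟨z, hz⟩ := ktR_eq p (s • x + t • y) 0 (by rw [hst]; ext i; simp [ktR])
  rw [zero_add] at hz
  have := h s t z hz
  simpa [ZMod.intCast_zmod_eq_zero_iff_dvd] using this

lemma kt_det_ne (p : ℕ) [Fact p.Prime] (w v x y : Fin 4 → ℤ)
    (h : LinearIndependent (ZMod p) ![ktR p w, ktR p v, ktR p x, ktR p y]) :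
    ¬ (p : ℤ) ∣ (Matrix.of ![w, v, x, y]).det := by
  intro hd
  have h1 : LinearIndependent (ZMod p)
      ((Int.castRingHom (ZMod p)).mapMatrix (Matrix.of ![w, v, x, y])).row := by
    convert h using 1
    ext i j
    fin_cases i <;> rfl
  rw [linearIndependent_rows_iff_isUnit, isUnit_iff_isUnit_det, ← RingHom.map_det] at h1
  apply h1.ne_zero
  exact (ZMod.intCast_zmod_eq_zero_iff_dvd _ _).2 hd

lemma kt_ext3 (p : ℕ) [Fact p.Prime] (v x y : Fin 4 → ℤ)
    (h : LinearIndependent (ZMod p) ![ktR p v, ktR p x, ktR p y]) :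
    ∃ w, ¬ (p : ℤ) ∣ (Matrix.of ![w, v, x, y]).det := by
  obtain ⟨w, hw⟩ := exists_linearIndependent_cons_of_lt_finrank h (by simp)
  obtain ⟨w, rfl⟩ := ktR_surj p w
  exact ⟨w, kt_det_ne p w v x y hw⟩

lemma kt_ext2 (p : ℕ) [Fact p.Prime] (x y : Fin 4 → ℤ)
    (h : LinearIndependent (ZMod p) ![ktR p x, ktR p y]) :
    ∃ w v, ¬ (p : ℤ) ∣ (Matrix.of ![w, v, x, y]).det := by
  obtain ⟨v, hv⟩ := exists_linearIndependent_cons_of_lt_finrank h (by simp)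
  obtain ⟨v, rfl⟩ := ktR_surj p v
  obtain ⟨w, hw⟩ := kt_ext3 p v x y hv
  exact ⟨w, v, hw⟩

lemma kt_dep (p : ℕ) [Fact p.Prime] (v x y : Fin 4 → ℤ)
    (h2 : LinearIndependent (ZMod p) ![ktR p x, ktR p y])
    (h : ¬ LinearIndependent (ZMod p) ![ktR p v, ktR p x, ktR p y]) :
    ∃ (a b : ℤ) (z : Fin 4 → ℤ), v = a • x + b • y + (p : ℤ) • z := by
  have : ktR p v ∈ Submodule.span (ZMod p) (Set.range ![ktR p x, ktR p y]) := by
    by_contra hn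
    exact h (linearIndependent_finCons.2 ⟨h2, hn⟩)
  rw [Matrix.range_cons_cons_empty, Submodule.mem_span_pair] at this
  obtain ⟨a, b, hab⟩ := this
  obtain ⟨a, rfl⟩ := ZMod.intCast_surjective a
  obtain ⟨b, rfl⟩ := ZMod.intCast_surjective b
  rw [ktR_lin] at hab
  obtain ⟨z, hz⟩ := ktR_eq p v (a • x + b • y) hab.symm
  exact ⟨a, b, z, hz⟩

lemma kt_gram4 (L : Matrix (Fin 4) (Fin 4) ℤ) (w v x y : Fin 4 → ℤ) :
    (!![ktB L w w, ktB L w v, ktB L w x, ktB L w y; ktB L v w, ktB L v v, ktB L v x, ktB L v y;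
       ktB L x w, ktB L x v, ktB L x x, ktB L x y; ktB L y w, ktB L y v, ktB L y x, ktB L y y]).det
      = L.det * (Matrix.of ![w, v, x, y]).det ^ 2 := by
  rw [← kt_gram_det]
  congr 1
  ext i j
  fin_cases i <;> fin_cases j <;> rfl

lemma kt_det4 (a b c d e f g h i j k l m n o r : ℤ) :
    (!![a, b, c, d; e, f, g, h; i, j, k, l; m, n, o, r]).det =
    a * (f * (k * r - l * o) - g * (j * r - l * n) + h * (j * o - k * n))
    - b * (e * (k * r - l * o) - g * (i * r - l * m) + h * (i * o - k * m))
    + c * (e * (j * r - l * n) - f * (i * r - l * m) + h * (i * n - j * m))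
    - d * (e * (j * o - k * n) - f * (i * o - k * m) + g * (i * n - j * m)) := by
  simp [Matrix.det_succ_row_zero, Fin.sum_univ_succ, Fin.succAbove, submatrix]
  ring

/-- Nonsquare discriminant: contradiction at `p`. -/
lemma kt_nonsquare_case (L : Matrix (Fin 4) (Fin 4) ℤ) (hL : L.IsSymm) (p q P : ℕ) (hp : p.Prime)
    (hP : Squarefree P) (hpP : p ∣ P) (hq : jacobiSym (-q) p = -1)
    (hd : jacobiSym L.det p = -1) (x y : Fin 4 → ℤ)
    (hxx : ktB L x x = P) (hxy : ktB L x y = 0) (hyy : ktB L y y = P * q) : False := by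
  have := Fact.mk hp
  obtain ⟨w, v, hk⟩ := kt_ext2 p x y
    (kt_LI2 p x y fun s t z h => kt_indep L hL p q P hp hP hq x y hxx hxy hyy s t z h)
  have hg := kt_gram4 L w v x y
  rw [kt_det4, ktB_symm L hL y x, ktB_symm L hL y w, ktB_symm L hL y v, ktB_symm L hL x w,
    ktB_symm L hL x v, ktB_symm L hL v w, hxx, hxy, hyy] at hg
  set k := (Matrix.of ![w, v, x, y]).det
  refine hk (jacobiSym.prime_dvd_of_eq_neg_one hd
    (x := ktB L w x * ktB L v y - ktB L w y * ktB L v x) ?_).2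
  obtain ⟨c, rfl⟩ := hpP
  rw [← hg]
  push_cast
  rw [← Int.modEq_zero_iff_dvd, ← ZMod.intCast_eq_intCast_iff]
  push_cast
  simp only [ZMod.natCast_self]
  ring

lemma kt_det_mod (p : ℕ) [Fact p.Prime] (L : Matrix (Fin 4) (Fin 4) ℤ) (hd : ¬ (p : ℤ) ∣ L.det)
    (y : Fin 4 → ℤ) (hy : ∀ z, y ≠ (p : ℤ) • z) : ∃ v, ¬ (p : ℤ) ∣ ktB L v y := by
  by_contra! h
  have h1 : ∀ i, (p : ℤ) ∣ (L.mulVec y) i := fun i => by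
    have := h (Pi.single i 1)
    simpa [ktB] using this
  have h2 : ((Int.castRingHom (ZMod p)).mapMatrix L).mulVec (ktR p y) = 0 := by
    ext i
    have := (ZMod.intCast_zmod_eq_zero_iff_dvd _ p).2 (h1 i)
    simp only [mulVec, dotProduct] at this ⊢
    push_cast at this
    simpa [ktR] using this
  by_cases h0 : ktR p y = 0
  · obtain ⟨z, hz⟩ := ktR_eq p y 0 (by rw [h0]; ext i; simp [ktR])
    exact hy z (by simpa using hz)
  · have := Matrix.exists_mulVec_eq_zero_iff.1 ⟨_, h0, h2⟩
    rw [← RingHom.map_det] at this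
    exact hd ((ZMod.intCast_zmod_eq_zero_iff_dvd _ _).1 this)

/-- Square discriminant: infinite descent. -/
lemma kt_descent (L : Matrix (Fin 4) (Fin 4) ℤ) (hL : IsPDForm L) (m q P : ℕ) (hqp : q.Prime)
    (hm : 0 < m) (hdet : L.det = m ^ 2) (hP : Squarefree P) (hqm : 8 * m ∣ q + 1)
    (x y : Fin 4 → ℤ)
    (hxx : ktB L x x = P) (hxy : ktB L x y = 0) (hyy : ktB L y y = P * q) (N : ℕ) :
    ∀ v, ¬ (q : ℤ) ∣ ktB L v y →
      P * q * ktB L v v - q * ktB L v x ^ 2 - ktB L v y ^ 2 = N → False := by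
  have hS := hL.1
  have hyx : ktB L y x = 0 := by rw [ktB_symm L hS]; exact hxy
  have hq3 : q % 4 = 3 := by
    have : 4 ∣ q + 1 := (show 4 ∣ 8 * m by omega).trans hqm
    omega
  have hqo : Odd q := by rw [Nat.odd_iff]; omega
  have hqZ : Prime (q : ℤ) := Nat.prime_iff_prime_int.mp hqp
  have := Fact.mk hqp
  induction N using Nat.strong_induction_on with
  | _ N ih =>
  intro v hv hN
  have hqN : ¬ (q : ℤ) ∣ N := by
    rintro ⟨c, hc⟩
    apply hv
    apply hqZ.dvd_of_dvd_pow (n := 2)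
    exact ⟨P * ktB L v v - ktB L v x ^ 2 - c, by linear_combination (-1 : ℤ) * hN + (-1 : ℤ) * hc⟩
  have hN0 : N ≠ 0 := by rintro rfl; simp at hqN
  have hJ : jacobiSym N q = -1 := by
    have h1 : jacobiSym (-(ktB L v y ^ 2)) q = -1 := by
      rw [jacobiSym.neg _ hqo, ZMod.χ₄_nat_three_mod_four hq3, jacobiSym.sq_one']
      · norm_num
      · rw [← Int.isCoprime_iff_gcd_eq_one]
        exact ((hqZ.coprime_iff_not_dvd).2 hv).symm
    rw [← h1]
    apply jacobiSym.mod_left'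
    rw [← hN]
    refine Int.emod_eq_emod_iff_emod_sub_eq_zero.2
      (Int.emod_eq_zero_of_dvd (Dvd.intro (P * ktB L v v - ktB L v x ^ 2) ?_))
    ring
  have hex : ∃ p, p.Prime ∧ p ∣ N ∧ jacobiSym p q ≠ 1 := by
    by_contra! hcon
    rw [kt_jac_prod q N hN0 hcon] at hJ
    norm_num at hJ
  obtain ⟨p, hp, hpN, hJp⟩ := hex
  have := Fact.mk hp
  have hpZ : Prime (p : ℤ) := Nat.prime_iff_prime_int.mp hp
  have hp2 : p ≠ 2 := by
    rintro rfl
    exact hJp (kt_jac_one 2 q (by norm_num) ((show 4 * 2 ∣ 8 * m by omega).trans hqm))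
  have hpm : ¬ p ∣ m := by
    rintro h
    exact hJp (kt_jac_one p q hp.pos
      ((mul_dvd_mul (show 4 ∣ 8 by norm_num) h).trans hqm))
  have hpq : p ≠ q := by
    rintro rfl
    exact hqN (by exact_mod_cast hpN)
  have hJ' : jacobiSym (-q) p = -1 := by
    rw [kt_recip p q (hp.odd_of_ne_two hp2) hq3]
    refine (jacobiSym.eq_one_or_neg_one ?_).resolve_left hJp
    rw [Int.gcd_natCast_natCast]
    exact (Nat.coprime_primes hp hqp).2 hpq
  have hLI := kt_LI2 p x y fun s t z h => kt_indep L hS p q P hp hP hJ' x y hxx hxy hyy s t z h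
  have hdep : ¬ LinearIndependent (ZMod p) ![ktR p v, ktR p x, ktR p y] := by
    intro hli
    obtain ⟨w, hk⟩ := kt_ext3 p v x y hli
    have hg := kt_gram4 L w v x y
    rw [kt_det4, hyx, ktB_symm L hS y w, ktB_symm L hS y v, ktB_symm L hS x w,
      ktB_symm L hS x v, ktB_symm L hS v w, hxx, hxy, hyy, hdet] at hg
    set k := (Matrix.of ![w, v, x, y]).det
    have hmk := (jacobiSym.prime_dvd_of_eq_neg_one hJ'
      (x := P * q * ktB L w v - q * ktB L w x * ktB L v x - ktB L w y * ktB L v y)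
      (y := m * k) ?_).2
    · rcases hpZ.dvd_or_dvd hmk with h | h
      · exact hpm (by exact_mod_cast h)
      · exact hk h
    · obtain ⟨c, hc⟩ := hpN
      have hN' : (N : ℤ) = p * c := by exact_mod_cast hc
      refine ⟨c * (P * q * ktB L w w - q * ktB L w x ^ 2 - ktB L w y ^ 2), ?_⟩
      rw [← mul_assoc, ← hN', ← hN]
      linear_combination (-(q : ℤ)) * hg
  obtain ⟨a, b, z, hz⟩ := kt_dep p v x y hLI hdep
  have hbx : ktB L v x = a * P + p * ktB L z x := by
    rw [hz]; simp only [ktB_add_left, ktB_smul_left, hxx, hyx]; ring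
  have hby : ktB L v y = b * (P * q) + p * ktB L z y := by
    rw [hz]; simp only [ktB_add_left, ktB_smul_left, hxy, hyy]; ring
  have hvv : ktB L v v = a ^ 2 * P + b ^ 2 * (P * q) + p ^ 2 * ktB L z z
      + 2 * a * p * ktB L z x + 2 * b * p * ktB L z y := by
    rw [hz]
    simp only [ktB_add_left, ktB_smul_left, ktB_add_right, ktB_smul_right, hxy, hyy, hxx, hyx,
      ktB_symm L hS x z, ktB_symm L hS y z]
    ring
  have hkey : (p : ℤ) ^ 2 * (P * q * ktB L z z - q * ktB L z x ^ 2 - ktB L z y ^ 2) = N := by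
    rw [← hN, hbx, hby, hvv]; ring
  have hpos : 0 < P * q * ktB L z z - q * ktB L z x ^ 2 - ktB L z y ^ 2 := by
    have h1 : (0 : ℤ) < N := by exact_mod_cast Nat.pos_of_ne_zero hN0
    rw [← hkey] at h1
    exact pos_of_mul_pos_right h1 (by positivity)
  obtain ⟨N', hN'⟩ := Int.eq_ofNat_of_zero_le hpos.le
  refine ih N' ?_ z ?_ hN'
  · rw [hN'] at hkey hpos
    have h1 : p ^ 2 * N' = N := by exact_mod_cast hkey
    have h2 : 0 < N' := by exact_mod_cast hpos
    rw [← h1]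
    exact lt_mul_of_one_lt_left h2 (Nat.one_lt_pow two_ne_zero hp.one_lt)
  · intro hdv
    apply hv
    rw [hby]
    exact dvd_add ⟨b * P, by ring⟩ (hdv.mul_left _)

lemma kt_square_case (L : Matrix (Fin 4) (Fin 4) ℤ) (hL : IsPDForm L) (m q P : ℕ) (hqp : q.Prime)
    (hm : 0 < m) (hdet : L.det = m ^ 2) (hP : Squarefree P) (hqP : ¬ q ∣ P) (hqm : 8 * m ∣ q + 1)
    (x y : Fin 4 → ℤ)
    (hxx : ktB L x x = P) (hxy : ktB L x y = 0) (hyy : ktB L y y = P * q) : False := by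
  have hS := hL.1
  have hyx : ktB L y x = 0 := by rw [ktB_symm L hS]; exact hxy
  have hqZ : Prime (q : ℤ) := Nat.prime_iff_prime_int.mp hqp
  have := Fact.mk hqp
  have hq0 : (0 : ℤ) < q := by exact_mod_cast hqp.pos
  have hP0 : (0 : ℤ) < P := by exact_mod_cast Nat.pos_of_ne_zero hP.ne_zero
  have hqd : ¬ (q : ℤ) ∣ L.det := by
    rw [hdet]
    intro h
    have h1 : q ∣ m := by exact_mod_cast hqZ.dvd_of_dvd_pow h
    have h2 : q ∣ q + 1 := (h1.mul_left 8).trans hqm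
    have h3 : q ∣ 1 := (Nat.dvd_add_right dvd_rfl).1 h2
    exact hqp.one_lt.ne' (Nat.dvd_one.1 h3)
  have hy : ∀ z, y ≠ (q : ℤ) • z := by
    rintro z rfl
    simp only [ktB_smul_left, ktB_smul_right] at hyy
    apply hqP
    have : (q : ℤ) ∣ P := ⟨ktB L z z, by
      apply mul_right_cancel₀ hq0.ne'
      linear_combination (-1 : ℤ) * hyy⟩
    exact_mod_cast this
  obtain ⟨v, hv⟩ := kt_det_mod q L hqd y hy
  have hnn := ktB_nonneg L hL ((P * q : ℤ) • v + (-(q * ktB L v x)) • x + (-(ktB L v y)) • y)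
  have e : ktB L ((P * q : ℤ) • v + (-(q * ktB L v x)) • x + (-(ktB L v y)) • y)
      ((P * q : ℤ) • v + (-(q * ktB L v x)) • x + (-(ktB L v y)) • y)
      = (P * q) * (P * q * ktB L v v - q * ktB L v x ^ 2 - ktB L v y ^ 2) := by
    simp only [ktB_add_left, ktB_smul_left, ktB_add_right, ktB_smul_right, hxy, hyy, hxx, hyx,
      ktB_symm L hS x v, ktB_symm L hS y v]
    ring
  rw [e] at hnn
  have hnn' := nonneg_of_mul_nonneg_right hnn (by positivity)
  obtain ⟨N, hN⟩ := Int.eq_ofNat_of_zero_le hnn'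
  exact kt_descent L hL m q P hqp hm hdet hP hqm x y hxx hxy hyy N v hv hN

lemma kt_det_pos {m : ℕ} (L : Matrix (Fin m) (Fin m) ℤ) (hL : IsPDForm L) : 0 < L.det := by
  have hne : L.det ≠ 0 := by
    intro h
    obtain ⟨v, hv, hv0⟩ := Matrix.exists_mulVec_eq_zero_iff.2 h
    have := hL.2 v hv
    rw [hv0] at this
    simp at this
  let A : Matrix (Fin m) (Fin m) ℝ := (Int.castRingHom ℝ).mapMatrix L
  have hrat : ∀ x : Fin m → ℚ, 0 ≤ (fun i => (x i : ℝ)) ⬝ᵥ A.mulVec (fun i => (x i : ℝ)) := by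
    intro x
    obtain ⟨b, hb⟩ := IsLocalization.exist_integer_multiples_of_finite (nonZeroDivisors ℤ) x
    choose y hy using hb
    have hb0 : ((b : ℤ) : ℝ) ≠ 0 := by
      exact_mod_cast nonZeroDivisors.ne_zero b.2
    have hxy : (fun i => (x i : ℝ)) = ((b : ℤ) : ℝ)⁻¹ • fun i => (y i : ℝ) := by
      ext i
      have h1 := hy i
      have h2 : ((y i : ℤ) : ℚ) = ((b : ℤ) : ℚ) * x i := by
        simpa using h1
      have h3 : ((y i : ℤ) : ℝ) = ((b : ℤ) : ℝ) * (x i : ℝ) := by exact_mod_cast congrArg (Rat.cast (K := ℝ)) h2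
      simp only [Pi.smul_apply, smul_eq_mul, h3]
      field_simp
    have hcast : (fun i => (y i : ℝ)) ⬝ᵥ A.mulVec (fun i => (y i : ℝ)) = (ktB L y y : ℝ) := by
      simp [ktB, A, dotProduct, mulVec]
    rw [hxy, mulVec_smul, smul_dotProduct, dotProduct_smul, hcast]
    have : (0 : ℝ) ≤ ktB L y y := by exact_mod_cast ktB_nonneg L hL y
    simp only [smul_eq_mul]
    rw [← mul_assoc]
    exact mul_nonneg (mul_self_nonneg _) this
  have hpsd : A.PosSemidef := by
    refine Matrix.PosSemidef.of_dotProduct_mulVec_nonneg ?_ ?_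
    · rw [Matrix.IsHermitian, conjTranspose_eq_transpose_of_trivial]
      ext i j
      have := congrFun (congrFun hL.1 i) j
      simp only [transpose_apply] at this
      simp [A, this]
    · intro x
      have hd : DenseRange (fun (v : Fin m → ℚ) (i : Fin m) => (v i : ℝ)) :=
        DenseRange.piMap (f := fun (_ : Fin m) (r : ℚ) => (r : ℝ)) fun _ => Rat.denseRange_cast
      have hcl : IsClosed {x : Fin m → ℝ | 0 ≤ x ⬝ᵥ A.mulVec x} := by
        apply isClosed_le continuous_const
        fun_prop
      have := hd.induction_on (p := fun x => 0 ≤ x ⬝ᵥ A.mulVec x) x hcl hrat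
      simpa using this
  have h0 := hpsd.det_nonneg
  have h1 : A.det = (L.det : ℝ) := by
    rw [← RingHom.map_det]; rfl
  rw [h1] at h0
  have h2 : 0 ≤ L.det := by exact_mod_cast h0
  omega

lemma kt_disjoint (a b c : ℤ) (δ p : ℕ) (hp : p.Prime) (hδ : (δ : ℤ) = a * c - b ^ 2)
    (hJ : jacobiSym (-δ) p = -1)
    (hpos : ∀ s t : ℤ, (s ≠ 0 ∨ t ≠ 0) → 0 < a * s ^ 2 + 2 * b * s * t + c * t ^ 2) (N : ℕ) :
    ∀ s t s' t' : ℤ, a * s ^ 2 + 2 * b * s * t + c * t ^ 2 =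
      p * (a * s' ^ 2 + 2 * b * s' * t' + c * t' ^ 2) →
      a * s ^ 2 + 2 * b * s * t + c * t ^ 2 = N → s = 0 ∧ t = 0 := by
  have := Fact.mk hp
  have hpZ : Prime (p : ℤ) := Nat.prime_iff_prime_int.mp hp
  have hp0 : (p : ℤ) ≠ 0 := hpZ.ne_zero
  induction N using Nat.strong_induction_on with
  | _ N ih =>
  intro s t s' t' h hN
  by_contra hst
  have hst' : s ≠ 0 ∨ t ≠ 0 := by tauto
  have hpos1 := hpos s t hst'
  have hpa : ¬ (p : ℤ) ∣ a := by
    rintro ⟨e, he⟩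
    have := (jacobiSym.prime_dvd_of_eq_neg_one hJ (x := b) (y := 1)
      ⟨e * c, by rw [hδ, he]; ring⟩).2
    exact hpZ.not_isUnit (isUnit_of_dvd_one this)
  obtain ⟨h1, h2⟩ := jacobiSym.prime_dvd_of_eq_neg_one hJ (x := a * s + b * t) (y := t)
    ⟨a * (a * s' ^ 2 + 2 * b * s' * t' + c * t' ^ 2), by
      rw [hδ]; linear_combination a * h⟩
  have h3 : (p : ℤ) ∣ a * s := (Int.dvd_add_left (h2.mul_left b)).1 h1
  have h4 := (hpZ.dvd_or_dvd h3).resolve_left hpa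
  obtain ⟨s2, rfl⟩ := h4
  obtain ⟨t2, rfl⟩ := h2
  have h5 : a * s' ^ 2 + 2 * b * s' * t' + c * t' ^ 2 =
      p * (a * s2 ^ 2 + 2 * b * s2 * t2 + c * t2 ^ 2) := by
    apply mul_left_cancel₀ hp0
    linear_combination (-1 : ℤ) * h
  have h6 : 0 < a * s' ^ 2 + 2 * b * s' * t' + c * t' ^ 2 := by
    rw [h] at hpos1
    exact pos_of_mul_pos_right hpos1 (by positivity)
  obtain ⟨N', hN'⟩ := Int.eq_ofNat_of_zero_le h6.le
  have h7 : N' < N := by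
    rw [h, hN'] at hN
    have h8 : p * N' = N := by exact_mod_cast hN
    rw [hN'] at h6
    have h9 : 0 < N' := by exact_mod_cast h6
    rw [← h8]
    exact lt_mul_of_one_lt_left h9 hp.one_lt
  obtain ⟨e1, e2⟩ := ih N' h7 s' t' s2 t2 h5 hN'
  subst e1; subst e2
  simp at h6

lemma kt_rep (L : Matrix (Fin 4) (Fin 4) ℤ) (N : Matrix (Fin 2) (Fin 2) ℤ) (h : Represents L N) :
    ∃ x y : Fin 4 → ℤ, ktB L x x = N 0 0 ∧ ktB L x y = N 0 1 ∧ ktB L y y = N 1 1 := by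
  obtain ⟨T, hT⟩ := h
  have key : ∀ i j, ktB L (fun k => T k i) (fun k => T k j) = N i j := by
    intro i j
    rw [← hT]
    simp only [ktB, dotProduct_mulVec]
    rfl
  exact ⟨_, _, key 0 0, key 0 1, key 1 1⟩

lemma kt_bound (ℓ : Matrix (Fin 2) (Fin 2) ℤ) (hℓ : IsPDForm ℓ) :
    ∃ ℓ₁ : Matrix (Fin 2) (Fin 2) ℤ, IsPDForm ℓ₁ ∧ ∃ D : ℕ,
      ∀ L : Matrix (Fin 4) (Fin 4) ℤ, IsPDForm L → Represents L ℓ → Represents L ℓ₁ →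
        L.det ≤ D := by
  obtain ⟨δ, hδ⟩ := Int.eq_ofNat_of_zero_le (kt_det_pos ℓ hℓ).le
  have hδ0 : 0 < δ := by
    have := kt_det_pos ℓ hℓ
    rw [hδ] at this; exact_mod_cast this
  have hs : ℓ 1 0 = ℓ 0 1 := hℓ.1.apply 0 1
  rw [det_fin_two, hs] at hδ
  obtain ⟨p, -, hp, hpm⟩ := Nat.forall_exists_prime_gt_and_modEq 0
      (q := 4 * δ) (a := 4 * δ - 1) (by positivity)
      ((Nat.coprime_self_sub_left (by omega)).2 (by simp))
  have hdvd : 4 * δ ∣ p + 1 := by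
    have := hpm.add_right 1
    rw [Nat.sub_add_cancel (by omega)] at this
    exact (Nat.modEq_zero_iff_dvd).1 (this.trans (by simp [Nat.ModEq]))
  have hJ := kt_jac_neg_one δ p hδ0 hdvd
  have hp0 : (0 : ℤ) < p := by exact_mod_cast hp.pos
  have hpos : ∀ s t : ℤ, (s ≠ 0 ∨ t ≠ 0) →
      0 < ℓ 0 0 * s ^ 2 + 2 * ℓ 0 1 * s * t + ℓ 1 1 * t ^ 2 := by
    intro s t hst
    have := hℓ.2 ![s, t] (by
      intro h
      have h0 := congrFun h 0
      have h1 := congrFun h 1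
      simp at h0 h1
      tauto)
    simp [dotProduct, mulVec, Fin.sum_univ_two, hs] at this
    linarith
  refine ⟨(p : ℤ) • ℓ, ⟨?_, ?_⟩, ?_⟩
  · rw [Matrix.IsSymm, transpose_smul, hℓ.1.eq]
  · intro x hx
    rw [smul_mulVec, dotProduct_smul, smul_eq_mul]
    exact mul_pos hp0 (hℓ.2 x hx)
  have ha : 0 < ℓ 0 0 := by simpa using hpos 1 0 (by simp)
  have hc : 0 < ℓ 1 1 := by simpa using hpos 0 1 (by simp)
  obtain ⟨K, hK⟩ := Int.eq_ofNat_of_zero_le (show 0 ≤ ℓ 0 0 + ℓ 1 1 + p * ℓ 0 0 + p * ℓ 1 1 by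
    positivity)
  refine ⟨Nat.factorial 4 * K ^ 4, ?_⟩
  intro L hL h1 h2
  obtain ⟨x, y, hxx, hxy, hyy⟩ := kt_rep L _ h1
  obtain ⟨z, w, hzz, hzw, hww⟩ := kt_rep L _ h2
  simp only [Matrix.smul_apply, smul_eq_mul] at hzz hzw hww
  have hS := hL.1
  set R : Matrix (Fin 4) (Fin 4) ℤ := Matrix.of ![x, y, z, w] with hR
  have hdiag : ∀ i, ktB L (R i) (R i) ≤ K := by
    rw [← hK]
    have e1 : 0 < p * ℓ 0 0 := by positivity
    have e2 : 0 < p * ℓ 1 1 := by positivity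
    intro i
    fin_cases i
    · change ktB L x x ≤ _; linarith
    · change ktB L y y ≤ _; linarith
    · change ktB L z z ≤ _; linarith
    · change ktB L w w ≤ _; linarith
  have hent : ∀ i j, |ktB L (R i) (R j)| ≤ K := by
    intro i j
    have e1 := ktB_nonneg L hL (R i + R j)
    have e2 := ktB_nonneg L hL (R i + (-1 : ℤ) • R j)
    simp only [ktB_add_left, ktB_smul_left, ktB_add_right, ktB_smul_right,
      ktB_symm L hS (R j) (R i)] at e1 e2
    have := hdiag i
    have := hdiag j
    rw [abs_le]; constructor <;> linarith
  have hdet := Matrix.det_le (A := Matrix.of fun i j => ktB L (R i) (R j))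
    (abv := AbsoluteValue.abs) (x := (K : ℤ)) hent
  rw [kt_gram_det] at hdet
  have hdet2 : L.det * R.det ^ 2 ≤ (Nat.factorial 4 * K ^ 4 : ℕ) := by
    refine (le_abs_self _).trans (hdet.trans (le_of_eq ?_))
    simp
  refine le_trans ?_ hdet2
  have hLp := kt_det_pos L hL
  suffices hR0 : R.det ≠ 0 by
    have : 0 < R.det ^ 2 := by positivity
    exact le_mul_of_one_le_right hLp.le this
  intro hR0
  obtain ⟨v, hv, hv0⟩ := Matrix.exists_vecMul_eq_zero_iff.2 hR0
  have hrel : v 0 • x + v 1 • y = (-1 : ℤ) • (v 2 • z + v 3 • w) := by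
    ext i
    have := congrFun hv0 i
    simp [vecMul, dotProduct, Fin.sum_univ_four, hR] at this
    simp
    linarith
  have hQ := congrArg (fun u => ktB L u u) hrel
  simp only [ktB_add_left, ktB_smul_left, ktB_add_right, ktB_smul_right, hxx, hxy, hyy, hzz, hzw,
    hww, ktB_symm L hS y x, ktB_symm L hS w z] at hQ
  have hQ' : ℓ 0 0 * v 0 ^ 2 + 2 * ℓ 0 1 * v 0 * v 1 + ℓ 1 1 * v 1 ^ 2 =
      p * (ℓ 0 0 * v 2 ^ 2 + 2 * ℓ 0 1 * v 2 * v 3 + ℓ 1 1 * v 3 ^ 2) := by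
    linear_combination hQ
  have hnn : 0 ≤ ℓ 0 0 * v 0 ^ 2 + 2 * ℓ 0 1 * v 0 * v 1 + ℓ 1 1 * v 1 ^ 2 := by
    by_cases h : v 0 ≠ 0 ∨ v 1 ≠ 0
    · exact (hpos _ _ h).le
    · push Not at h
      simp [h.1, h.2]
  obtain ⟨N, hN⟩ := Int.eq_ofNat_of_zero_le hnn
  obtain ⟨e0, e1⟩ := kt_disjoint (ℓ 0 0) (ℓ 0 1) (ℓ 1 1) δ p hp
    (by have : ((δ : ℕ) : ℤ) = Int.ofNat δ := rfl
        rw [← hδ]; ring) hJ hpos N _ _ _ _ hQ' hN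
  have h23 : v 2 = 0 ∧ v 3 = 0 := by
    by_contra hcon
    have := hpos (v 2) (v 3) (by tauto)
    rw [e0, e1] at hQ'
    have h0 : (p : ℤ) * (ℓ 0 0 * v 2 ^ 2 + 2 * ℓ 0 1 * v 2 * v 3 + ℓ 1 1 * v 3 ^ 2) = 0 := by
      rw [← hQ']; ring
    have := mul_pos hp0 this
    omega
  apply hv
  ext i
  fin_cases i
  · exact e0
  · exact e1
  · exact h23.1
  · exact h23.2

lemma kt_exists_P (N : ℕ) (hN : 0 < N) (n : ℕ) : ∃ P : ℕ, Squarefree P ∧ Nat.Coprime P N ∧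
    ∀ d, 0 < d → d ≤ n → ¬ IsSquare d →
      ∃ p, p.Prime ∧ p ∣ P ∧ p % 4 = 3 ∧ jacobiSym d p = -1 := by
  induction n with
  | zero => exact ⟨1, squarefree_one, by simp, fun d h1 h2 => by omega⟩
  | succ n ih =>
    obtain ⟨P, hP, hPN, h⟩ := ih
    by_cases hs : IsSquare (n + 1)
    · refine ⟨P, hP, hPN, fun d h1 h2 h3 => ?_⟩
      rcases Nat.lt_or_ge n d with h4 | h4
      · obtain rfl : d = n + 1 := by omega
        exact absurd hs h3
      · exact h d h1 h4 h3
    · obtain ⟨p, hpg, hp, hp3, hJ⟩ := kt_inert_prime (n + 1) (by omega) hs (P + N)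
      have hP0 : 0 < P := Nat.pos_of_ne_zero hP.ne_zero
      have c1 : Nat.Coprime P p := by
        apply Nat.Coprime.symm
        rw [hp.coprime_iff_not_dvd]
        intro hd
        have := Nat.le_of_dvd hP0 hd
        omega
      have c2 : Nat.Coprime p N := by
        rw [hp.coprime_iff_not_dvd]
        intro hd
        have := Nat.le_of_dvd hN hd
        omega
      refine ⟨P * p, (Nat.squarefree_mul c1).2 ⟨hP, hp.squarefree⟩, Nat.Coprime.mul_left hPN c2,
        fun d h1 h2 h3 => ?_⟩
      rcases Nat.lt_or_ge n d with h4 | h4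
      · obtain rfl : d = n + 1 := by omega
        exact ⟨p, hp, dvd_mul_left _ _, hp3, hJ⟩
      · obtain ⟨r, hr, hrP, h5⟩ := h d h1 h4 h3
        exact ⟨r, hr, hrP.mul_right _, h5⟩

/-- For every positive definite integral binary form ℓ there are a binary form ℓ₁ and
infinitely many pairwise non-isometric binary forms ℓ₂ such that no positive definite
integral quaternary form represents ℓ, ℓ₁ and ℓ₂ simultaneously. -/
theorem kappa_two_four (ℓ : Matrix (Fin 2) (Fin 2) ℤ) (hℓ : IsPDForm ℓ) :
    ∃ ℓ₁ : Matrix (Fin 2) (Fin 2) ℤ, IsPDForm ℓ₁ ∧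
      ∃ f : ℕ → Matrix (Fin 2) (Fin 2) ℤ,
        (∀ i, IsPDForm (f i)) ∧
        (∀ i j, i ≠ j → ¬ IsomForm (f i) (f j)) ∧
        (∀ i, ¬ ∃ L : Matrix (Fin 4) (Fin 4) ℤ, IsPDForm L ∧
          Represents L ℓ ∧ Represents L ℓ₁ ∧ Represents L (f i)) := by
  obtain ⟨ℓ₁, hℓ₁, D, hD⟩ := kt_bound ℓ hℓ
  refine ⟨ℓ₁, hℓ₁, ?_⟩
  have hfac := Nat.factorial_pos D
  obtain ⟨P, hP, hPc, hPp⟩ := kt_exists_P (8 * D.factorial) (by omega) D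
  have hP0 : 0 < P := Nat.pos_of_ne_zero hP.ne_zero
  obtain ⟨c, hc1, hc2⟩ := Nat.chineseRemainder hPc 1 (8 * D.factorial - 1)
  have hcc : Nat.Coprime c (P * (8 * D.factorial)) := by
    apply Nat.Coprime.mul_right
    · rw [Nat.Coprime, hc1.gcd_eq]; simp
    · rw [Nat.Coprime, hc2.gcd_eq]
      exact (Nat.coprime_self_sub_left (by omega)).2 (by simp)
  have hinf := Nat.infinite_setOfPred_prime_and_modEq (q := P * (8 * D.factorial)) (a := c)
    (by positivity) hcc
  let e := hinf.natEmbedding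
  let q : ℕ → ℕ := fun i => (e i : ℕ)
  have hqi : Function.Injective q := fun i j h => e.injective (Subtype.ext h)
  have hqp : ∀ i, (q i).Prime := fun i => (e i).2.1
  have hqm : ∀ i, q i ≡ c [MOD P * (8 * D.factorial)] := fun i => (e i).2.2
  have hP0' : (0 : ℤ) < P := by exact_mod_cast hP0
  have hq0 : ∀ i, (0 : ℤ) < q i := fun i => by exact_mod_cast (hqp i).pos
  refine ⟨fun i => !![(P : ℤ), 0; 0, P * q i], ?_, ?_, ?_⟩
  · intro i
    constructor
    · ext a b; fin_cases a <;> fin_cases b <;> rfl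
    · intro x hx
      have hx' : x 0 ≠ 0 ∨ x 1 ≠ 0 := by
        by_contra! h
        apply hx
        ext j; fin_cases j
        · exact h.1
        · exact h.2
      have e1 : x ⬝ᵥ (!![(P : ℤ), 0; 0, P * q i]).mulVec x = P * (x 0 ^ 2 + q i * x 1 ^ 2) := by
        simp [dotProduct, mulVec, Fin.sum_univ_two]; ring
      rw [e1]
      have := hq0 i
      rcases hx' with h | h <;> positivity
  · rintro i j hij ⟨U, hU, hUe⟩
    have h1 := congrArg Matrix.det hUe
    rw [det_mul, det_mul, det_transpose, det_fin_two_of, det_fin_two_of] at h1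
    have h2 : U.det * U.det = 1 := by
      rcases Int.isUnit_iff.1 hU with h | h <;> rw [h] <;> norm_num
    apply hij
    apply hqi
    have h3 : (P : ℤ) * P * q i = P * P * q j := by
      linear_combination h1 - (P * (P * q i)) * h2
    exact_mod_cast mul_left_cancel₀ (by positivity) h3
  · rintro i ⟨L, hL, r0, r1, r2⟩
    have hdet := hD L hL r0 r1
    have hpos := kt_det_pos L hL
    obtain ⟨x, y, hxx, hxy, hyy⟩ := kt_rep L _ r2
    simp only [of_apply, cons_val_zero, cons_val_one, cons_val', cons_val_fin_one] at hxx hxy hyy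
    obtain ⟨d, hd⟩ := Int.eq_ofNat_of_zero_le hpos.le
    have hd0 : 0 < d := by rw [hd] at hpos; exact_mod_cast hpos
    have hdD : d ≤ D := by rw [hd] at hdet; exact_mod_cast hdet
    have hq1 : q i ≡ 1 [MOD P] := ((hqm i).of_mul_right _).trans hc1
    have hq8 : 8 * D.factorial ∣ q i + 1 := by
      have := (((hqm i).of_mul_left _).trans hc2).add_right 1
      rw [Nat.sub_add_cancel (by omega)] at this
      exact (Nat.modEq_zero_iff_dvd).1 (this.trans (by simp [Nat.ModEq]))
    by_cases hsq : IsSquare d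
    · obtain ⟨m, rfl⟩ := hsq
      have hm : 0 < m := Nat.pos_of_mul_pos_left hd0
      refine kt_square_case L hL m (q i) P (hqp i) hm (by rw [hd]; push_cast; ring) hP ?_ ?_
        x y hxx hxy hyy
      · intro hdv
        have h1 : Nat.gcd (q i) P = 1 := by rw [hq1.gcd_eq]; simp
        rw [Nat.gcd_eq_left hdv] at h1
        exact (hqp i).one_lt.ne' h1
      · refine (mul_dvd_mul_left 8 (Nat.dvd_factorial hm ?_)).trans hq8
        nlinarith
    · obtain ⟨p, hp, hpP, hp3, hJ⟩ := hPp d hd0 hdD hsq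
      refine kt_nonsquare_case L hL.1 p (q i) P hp hP hpP ?_ (by rw [hd]; exact hJ) x y hxx hxy hyy
      have hpo : Odd p := by rw [Nat.odd_iff]; omega
      have h1 : jacobiSym (-1) p = -1 := by
        rw [jacobiSym.at_neg_one hpo, ZMod.χ₄_nat_three_mod_four hp3]
      rw [← h1]
      apply jacobiSym.mod_left'
      have : (q i : ℤ) ≡ (1 : ℕ) [ZMOD p] := (Int.natCast_modEq_iff).2 (hq1.of_dvd hpP)
      exact this.neg
end
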